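/- arXiv:2207.04464 — 8 statements merged into one kernel-verified Lean document; each statement's English description precedes it below -/
import Mathlib

section
/- Let 0 < α < 1. Then for every η > 0 one has 0 ≤ E_{α,α}(−η) ≤ 1/Γ(α), and moreover the map η ↦ E_{α,α}(−η) is monotonically decreasing on (0,∞). -/
/-- The two-parameter Mittag-Leffler function `E_{α,β}(z) = ∑ z^k / Γ(αk+β)`. -/
noncomputable def mittagLeffler (α β z : ℝ) : ℝ :=
  ∑' k : ℕ, z ^ k / Real.Gamma (α * (k : ℝ) + β)

open Finset Filter Topology

theorem Ring.multichoose_eq_prod_div_factorial (s : ℝ) (n : ℕ) :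
    Ring.multichoose s n = (∏ i ∈ range n, (s + i)) / n.factorial := by
  have h := Ring.factorial_nsmul_multichoose_eq_ascPochhammer s n
  rw [Polynomial.ascPochhammer_smeval_eq_eval, nsmul_eq_mul] at h
  have hprod : (ascPochhammer ℝ n).eval s = ∏ i ∈ range n, (s + i) := by
    clear h
    induction n with
    | zero => simp
    | succ n ih => rw [ascPochhammer_succ_eval, ih, prod_range_succ]
  rw [eq_div_iff (by positivity), mul_comm, h, hprod]

/-- The Chu-Vandermonde identity for rising factorials. -/
theorem Ring.multichoose_add_eq_sum (r s : ℝ) (n : ℕ) :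
    Ring.multichoose (r + s) n =
      ∑ ij ∈ antidiagonal n, Ring.multichoose r ij.1 * Ring.multichoose s ij.2 := by
  have key : ∀ (t : ℝ) (m : ℕ), Ring.multichoose t m = (-1) ^ m * Ring.choose (-t) m := by
    intro t m
    rw [Ring.choose_neg', Units.smul_def, zsmul_eq_mul, Int.cast_negOnePow_natCast, ← mul_assoc,
      ← mul_pow]
    simp
  rw [key, neg_add, Ring.add_choose_eq n (Commute.all _ _), mul_sum]
  refine sum_congr rfl fun ij hij => ?_
  rw [key r, key s, ← mem_antidiagonal.mp hij, pow_add]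
  ring

theorem Ring.multichoose_nonneg {s : ℝ} (hs : 0 ≤ s) (n : ℕ) : 0 ≤ Ring.multichoose s n := by
  rw [Ring.multichoose_eq_prod_div_factorial]
  positivity

theorem Ring.multichoose_le_multichoose {s t : ℝ} (hs : 0 ≤ s) (hst : s ≤ t) (n : ℕ) :
    Ring.multichoose s n ≤ Ring.multichoose t n := by
  rw [Ring.multichoose_eq_prod_div_factorial, Ring.multichoose_eq_prod_div_factorial]
  gcongr

theorem Ring.multichoose_neg_succ_nonpos {α : ℝ} (h0 : 0 ≤ α) (h1 : α ≤ 1) (n : ℕ) :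
    Ring.multichoose (-α) (n + 1) ≤ 0 := by
  rw [Ring.multichoose_eq_prod_div_factorial, prod_range_succ']
  refine div_nonpos_of_nonpos_of_nonneg (mul_nonpos_of_nonneg_of_nonpos ?_ (by simpa)) (by positivity)
  refine prod_nonneg fun i _ => ?_
  push_cast
  have : (0 : ℝ) ≤ i := i.cast_nonneg
  linarith

theorem summable_pow_mul_multichoose {α x : ℝ} (h0 : 0 ≤ α) (h1 : α ≤ 1) (hx : |x| < 1) (n : ℕ) :
    Summable fun k : ℕ => x ^ k * Ring.multichoose (α * k + α) n := by
  have hg := summable_choose_mul_geometric_of_norm_lt_one (R := ℝ) n (r := |x|) (by simpa using hx)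
  refine Summable.of_norm_bounded hg fun k => ?_
  have hs : 0 ≤ α * k + α := by positivity
  have hle : Ring.multichoose (α * k + α) n ≤ ((k + n).choose n : ℝ) := by
    refine (Ring.multichoose_le_multichoose hs (t := k + 1) ?_ n).trans_eq ?_
    · have : (0 : ℝ) ≤ k := k.cast_nonneg
      nlinarith
    · rw [Ring.multichoose_eq, ← Ring.choose_natCast]
      congr 1
      push_cast
      ring
  rw [norm_mul, norm_pow, Real.norm_eq_abs, Real.norm_eq_abs,
    abs_of_nonneg (Ring.multichoose_nonneg hs n), mul_comm]
  gcongr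

/-- The coefficient of `z ^ n` in the power series of `1 / (μ + (1 - z) ^ α)`, for `|μ| < 1`. -/
noncomputable def resolventCoeff (α μ : ℝ) (n : ℕ) : ℝ :=
  ∑' k : ℕ, (-μ) ^ k * Ring.multichoose (α * k + α) n

theorem one_add_mul_resolventCoeff {α μ : ℝ} (h0 : 0 ≤ α) (h1 : α ≤ 1) (hμ : |μ| < 1) (n : ℕ) :
    (1 + μ) * resolventCoeff α μ n = Ring.multichoose 0 n +
      ∑ i ∈ range n, -Ring.multichoose (-α) (i + 1) * resolventCoeff α μ (n - (i + 1)) := by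
  have hsum := summable_pow_mul_multichoose h0 h1 (x := -μ) (by simpa using hμ)
  have hconv : ∑ ij ∈ antidiagonal n, Ring.multichoose (-α) ij.1 * resolventCoeff α μ ij.2 =
      ∑' k : ℕ, (-μ) ^ k * Ring.multichoose (α * k) n := by
    simp only [resolventCoeff, ← tsum_mul_left]
    have hterm : ∀ ij ∈ antidiagonal n, Summable fun k : ℕ => Ring.multichoose (-α) ij.1 *
        ((-μ) ^ k * Ring.multichoose (α * k + α) ij.2) := fun ij _ => (hsum ij.2).mul_left _
    rw [← Summable.tsum_finsetSum hterm]
    refine tsum_congr fun k => ?_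
    rw [show α * k = -α + (α * k + α) by ring, Ring.multichoose_add_eq_sum, mul_sum]
    refine sum_congr rfl fun ij _ => ?_
    rw [show -α + (α * k + α) + α = α * k + α by ring]
    ring
  have hshift : ∀ k : ℕ, (-μ) ^ (k + 1) * Ring.multichoose (α * (k + 1 : ℕ)) n =
      -μ * ((-μ) ^ k * Ring.multichoose (α * k + α) n) := by
    intro k
    rw [show α * (k + 1 : ℕ) = α * k + α by push_cast; ring]
    ring
  have hsum' : Summable fun k : ℕ => (-μ) ^ k * Ring.multichoose (α * k) n := by
    rw [← summable_nat_add_iff 1]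
    simpa only [hshift] using (hsum n).mul_left (-μ)
  rw [hsum'.tsum_eq_zero_add] at hconv
  simp only [hshift, tsum_mul_left] at hconv
  rw [Nat.sum_antidiagonal_eq_sum_range_succ
    (fun i j => Ring.multichoose (-α) i * resolventCoeff α μ j), sum_range_succ'] at hconv
  simp only [Nat.cast_zero, mul_zero, pow_zero, one_mul, Ring.multichoose_zero_right,
    Nat.sub_zero] at hconv
  simp only [neg_mul, sum_neg_distrib]
  have hdef : ∑' k : ℕ, (-μ) ^ k * Ring.multichoose (α * k + α) n = resolventCoeff α μ n := rfl
  rw [hdef] at hconv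
  linarith

theorem resolventCoeff_nonneg_and_antitone {α μ ν : ℝ} (h0 : 0 ≤ α) (h1 : α ≤ 1) (hμ : 0 ≤ μ)
    (hμν : μ ≤ ν) (hν : ν < 1) (n : ℕ) :
    0 ≤ resolventCoeff α ν n ∧ resolventCoeff α ν n ≤ resolventCoeff α μ n := by
  induction n using Nat.strong_induction_on with
  | _ n ih =>
    have eμ := one_add_mul_resolventCoeff h0 h1
      (show |μ| < 1 by rw [abs_of_nonneg hμ]; linarith) n
    have eν := one_add_mul_resolventCoeff h0 h1
      (show |ν| < 1 by rw [abs_of_nonneg (hμ.trans hμν)]; linarith) n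
    have hp : ∀ i, 0 ≤ -Ring.multichoose (-α) (i + 1) := fun i =>
      neg_nonneg.mpr (Ring.multichoose_neg_succ_nonpos h0 h1 i)
    have hν0 : 0 ≤ (1 + ν) * resolventCoeff α ν n := by
      rw [eν]
      refine add_nonneg (Ring.multichoose_nonneg le_rfl n) (sum_nonneg fun i hi => ?_)
      exact mul_nonneg (hp i) (ih _ (by have := mem_range.mp hi; omega)).1
    have hle : (1 + ν) * resolventCoeff α ν n ≤ (1 + μ) * resolventCoeff α μ n := by
      rw [eν, eμ]
      gcongr with i hi
      · exact hp i
      · exact (ih _ (by have := mem_range.mp hi; omega)).2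
    have hc : 0 ≤ resolventCoeff α μ n :=
      nonneg_of_mul_nonneg_right (hν0.trans hle) (by linarith)
    refine ⟨nonneg_of_mul_nonneg_right hν0 (by linarith), ?_⟩
    refine le_of_mul_le_mul_left (hle.trans ?_) (show 0 < 1 + ν by linarith)
    gcongr

theorem Real.GammaSeq_pos {s : ℝ} (hs : 0 < s) {n : ℕ} (hn : 1 ≤ n) : 0 < Real.GammaSeq s n := by
  have : (0 : ℝ) < n := by exact_mod_cast hn
  unfold Real.GammaSeq
  have : 0 < ∏ j ∈ range (n + 1), (s + j) := prod_pos fun j _ => by positivity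
  positivity

theorem Real.GammaSeq_le_succ {s : ℝ} (hs : 0 < s) {n : ℕ} (hn : 1 ≤ n) :
    Real.GammaSeq s n ≤ Real.GammaSeq s (n + 1) := by
  have hn' : (0 : ℝ) < n := by exact_mod_cast hn
  have hP : 0 < ∏ j ∈ range (n + 1), (s + j) := prod_pos fun j _ => by positivity
  have hpow : (n : ℝ) ^ s * (s + (n + 1)) ≤ (n + 1 : ℝ) ^ s * (n + 1) := by
    have hlog := Real.one_sub_inv_le_log_of_pos (x := (n + 1) / n) (by positivity)
    have hexp := Real.add_one_le_exp (s * Real.log ((n + 1) / n))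
    rw [mul_comm s, ← Real.rpow_def_of_pos (by positivity),
      Real.div_rpow (by positivity) (by positivity), le_div_iff₀ (by positivity)] at hexp
    have h1 : s / (n + 1) ≤ Real.log ((n + 1) / n) * s := by
      refine le_trans (le_of_eq ?_) (mul_le_mul_of_nonneg_right hlog hs.le)
      field_simp
      ring
    calc (n : ℝ) ^ s * (s + (n + 1)) = (s / (n + 1) + 1) * n ^ s * (n + 1) := by field_simp
      _ ≤ (n + 1 : ℝ) ^ s * (n + 1) := by
        gcongr
        refine le_trans ?_ hexp
        gcongr
  unfold Real.GammaSeq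
  rw [prod_range_succ _ (n + 1), div_le_div_iff₀ hP (by positivity), Nat.factorial_succ]
  push_cast
  calc (n : ℝ) ^ s * n.factorial * ((∏ j ∈ range (n + 1), (s + j)) * (s + (n + 1)))
      = (n : ℝ) ^ s * (s + (n + 1)) * (n.factorial * ∏ j ∈ range (n + 1), (s + j)) := by ring
    _ ≤ (n + 1 : ℝ) ^ s * (n + 1) * (n.factorial * ∏ j ∈ range (n + 1), (s + j)) := by gcongr
    _ = _ := by ring

theorem Real.GammaSeq_mono {s : ℝ} (hs : 0 < s) {m n : ℕ} (hm : 1 ≤ m) (hmn : m ≤ n) :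
    Real.GammaSeq s m ≤ Real.GammaSeq s n := by
  induction n, hmn using Nat.le_induction with
  | base => exact le_rfl
  | succ n hn ih => exact ih.trans (Real.GammaSeq_le_succ hs (hm.trans hn))

theorem pow_div_GammaSeq_eq {α : ℝ} (x : ℝ) {n : ℕ} (hn : 1 ≤ n) (k : ℕ) :
    x ^ k / Real.GammaSeq (α * k + α) n = (n + 1) * (n : ℝ) ^ (-α) *
      ((x * (n : ℝ) ^ (-α)) ^ k * Ring.multichoose (α * k + α) (n + 1)) := by
  have hn' : (0 : ℝ) < n := by exact_mod_cast hn
  have hpow : (n : ℝ) ^ (α * k + α) = ((n : ℝ) ^ α) ^ k * (n : ℝ) ^ α := by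
    rw [Real.rpow_add hn', Real.rpow_mul hn'.le, Real.rpow_natCast]
  have hA : (0 : ℝ) < (n : ℝ) ^ α := by positivity
  rw [Real.GammaSeq, Ring.multichoose_eq_prod_div_factorial, hpow, Real.rpow_neg hn'.le,
    Nat.factorial_succ, mul_pow, inv_pow]
  push_cast
  field_simp

theorem tendsto_resolventCoeff {α η : ℝ} (h0 : 0 < α) (h1 : α ≤ 1) :
    Tendsto (fun n : ℕ => (n + 1) * (n : ℝ) ^ (-α) * resolventCoeff α (η * (n : ℝ) ^ (-α)) (n + 1))
      atTop (𝓝 (mittagLeffler α α (-η))) := by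
  have hsmall : Tendsto (fun n : ℕ => |η| * (n : ℝ) ^ (-α)) atTop (𝓝 0) := by
    simpa using ((tendsto_rpow_neg_atTop h0).comp tendsto_natCast_atTop_atTop).const_mul |η|
  obtain ⟨N, hN, hN1⟩ := ((hsmall.eventually (gt_mem_nhds one_pos)).and
    (eventually_ge_atTop 1)).exists
  have hs : ∀ k : ℕ, 0 < α * k + α := fun k => by positivity
  have hbound : Summable fun k : ℕ => |η| ^ k / Real.GammaSeq (α * k + α) N := by
    simp only [pow_div_GammaSeq_eq |η| hN1]
    refine (summable_pow_mul_multichoose h0.le h1 ?_ _).mul_left _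
    rwa [abs_of_nonneg (by positivity)]
  have hlim := tendsto_tsum_of_dominated_convergence (𝓕 := atTop)
    (f := fun (n : ℕ) (k : ℕ) => (-η) ^ k / Real.GammaSeq (α * k + α) n)
    (g := fun k => (-η) ^ k / Real.Gamma (α * k + α)) hbound
    (fun k => tendsto_const_nhds.div (Real.GammaSeq_tendsto_Gamma _)
      (Real.Gamma_pos_of_pos (hs k)).ne') (by
      filter_upwards [eventually_ge_atTop N] with n hn k
      have hpos := Real.GammaSeq_pos (hs k) hN1
      have hle := Real.GammaSeq_mono (hs k) hN1 hn
      rw [norm_div, norm_pow, norm_neg, Real.norm_eq_abs, Real.norm_eq_abs,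
        abs_of_pos (hpos.trans_le hle)]
      gcongr)
  refine hlim.congr' ?_
  filter_upwards [eventually_ge_atTop 1] with n hn
  simp only [pow_div_GammaSeq_eq (-η) hn, tsum_mul_left, resolventCoeff, neg_mul]

theorem mittagLeffler_self_neg_nonneg_and_le {α μ ν : ℝ} (h0 : 0 < α) (h1 : α ≤ 1) (hμ : 0 ≤ μ)
    (hμν : μ ≤ ν) :
    0 ≤ mittagLeffler α α (-ν) ∧ mittagLeffler α α (-ν) ≤ mittagLeffler α α (-μ) := by
  have hsmall : Tendsto (fun n : ℕ => ν * (n : ℝ) ^ (-α)) atTop (𝓝 0) := by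
    simpa using ((tendsto_rpow_neg_atTop h0).comp tendsto_natCast_atTop_atTop).const_mul ν
  have hev : ∀ᶠ n : ℕ in atTop,
      0 ≤ resolventCoeff α (ν * (n : ℝ) ^ (-α)) (n + 1) ∧
        resolventCoeff α (ν * (n : ℝ) ^ (-α)) (n + 1) ≤
          resolventCoeff α (μ * (n : ℝ) ^ (-α)) (n + 1) := by
    filter_upwards [hsmall.eventually (gt_mem_nhds one_pos)] with n hn
    exact resolventCoeff_nonneg_and_antitone h0.le h1 (by positivity) (by gcongr) hn _
  constructor
  · refine ge_of_tendsto (tendsto_resolventCoeff h0 h1) (hev.mono fun n hn => ?_)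
    exact mul_nonneg (by positivity) hn.1
  · refine le_of_tendsto_of_tendsto (tendsto_resolventCoeff h0 h1) (tendsto_resolventCoeff h0 h1)
      (hev.mono fun n hn => ?_)
    exact mul_le_mul_of_nonneg_left hn.2 (by positivity)

theorem mittagLeffler_zero (α β : ℝ) : mittagLeffler α β 0 = 1 / Real.Gamma β := by
  rw [mittagLeffler, tsum_eq_single 0 fun k hk => by simp [hk]]
  simp

/-- For `0 < α < 1` and `η > 0`, `0 ≤ E_{α,α}(−η) ≤ 1/Γ(α)`, and
`η ↦ E_{α,α}(−η)` is monotonically decreasing on `(0,∞)`. -/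
theorem mittagLeffler_neg_bounds_and_antitone (α : ℝ) (hα0 : 0 < α) (hα1 : α < 1) :
    (∀ η : ℝ, 0 < η →
      0 ≤ mittagLeffler α α (-η) ∧ mittagLeffler α α (-η) ≤ 1 / Real.Gamma α) ∧
    AntitoneOn (fun η : ℝ => mittagLeffler α α (-η)) (Set.Ioi 0) := by
  refine ⟨fun η hη => ?_, fun μ hμ ν _ hμν =>
    (mittagLeffler_self_neg_nonneg_and_le hα0 hα1.le (Set.mem_Ioi.mp hμ).le hμν).2⟩
  have h := mittagLeffler_self_neg_nonneg_and_le hα0 hα1.le le_rfl hη.le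
  rwa [neg_zero, mittagLeffler_zero] at h
end

section
/- Let 0 < α < 1, T > 0, and let v : [0,T] → ℝ be continuous with integrable derivative on (0,T) and monotone. Then for every t ∈ (0,T], v(t)·D^α v(t) ≥ (1/2)·D^α(v²)(t), where v² denotes the pointwise square of v. -/
open MeasureTheory

/-- The (left) Caputo fractional derivative of order `α`. -/
noncomputable def caputoDeriv (α : ℝ) (u : ℝ → ℝ) (t : ℝ) : ℝ :=
  (Real.Gamma (1 - α))⁻¹ * ∫ s in (0:ℝ)..t, (t - s) ^ (-α) * deriv u s

theorem integrableOn_kernel_mul_of_mul {α t : ℝ} (hα : 0 < α) (ht : 0 < t) {v g : ℝ → ℝ}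
    (hc : ContinuousOn v (Set.Icc 0 t)) (hg : IntegrableOn g (Set.Ioo 0 t)) (hvt : 0 < v t)
    (hi : IntegrableOn (fun s => v s * ((t - s) ^ (-α) * g s)) (Set.Ioo 0 t)) :
    IntegrableOn (fun s => (t - s) ^ (-α) * g s) (Set.Ioo 0 t) := by
  have hev : ∀ᶠ s in nhdsWithin t (Set.Icc 0 t), v t / 2 < v s :=
    (hc t ⟨ht.le, le_rfl⟩).eventually (lt_mem_nhds (by linarith))
  obtain ⟨δ, hδ, hball⟩ := Metric.eventually_nhds_iff.1 (eventually_nhdsWithin_iff.1 hev)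
  have hk : AEStronglyMeasurable (fun s : ℝ => (t - s) ^ (-α)) :=
    (by fun_prop : Measurable fun s : ℝ => (t - s) ^ (-α)).aestronglyMeasurable
  have hleft : IntegrableOn (fun s => (t - s) ^ (-α) * g s) (Set.Ioo 0 t ∩ Set.Iic (t - δ / 2)) := by
    refine Integrable.bdd_mul (c := (δ / 2) ^ (-α)) (hg.mono_set Set.inter_subset_left)
      hk.restrict ?_
    refine (ae_restrict_iff' (measurableSet_Ioo.inter measurableSet_Iic)).2 (.of_forall ?_)
    rintro s ⟨⟨hs0, hst⟩, hs⟩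
    have hs : s ≤ t - δ / 2 := hs
    rw [Real.norm_of_nonneg (Real.rpow_nonneg (by linarith) _)]
    exact Real.rpow_le_rpow_of_nonpos (by linarith) (by linarith) (by linarith)
  have hright : IntegrableOn (fun s => (t - s) ^ (-α) * g s)
      (Set.Ioo 0 t ∩ Set.Ioi (t - δ / 2)) := by
    refine Integrable.mono' (((hi.mono_set Set.inter_subset_left).norm).const_mul (v t / 2)⁻¹)
      (hk.restrict.mul (hg.mono_set Set.inter_subset_left).1) ?_
    refine (ae_restrict_iff' (measurableSet_Ioo.inter measurableSet_Ioi)).2 (.of_forall ?_)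
    rintro s ⟨⟨hs0, hst⟩, hs⟩
    have hs : t - δ / 2 < s := hs
    have hv : v t / 2 < v s := hball
      (by rw [Real.dist_eq, abs_lt]; constructor <;> linarith) ⟨hs0.le, hst.le⟩
    rw [norm_mul (v s), Real.norm_of_nonneg (by linarith : 0 ≤ v s), ← div_eq_inv_mul,
      le_div_iff₀ (by linarith), mul_comm]
    exact mul_le_mul_of_nonneg_right hv.le (norm_nonneg _)
  have := hleft.union hright
  rwa [← Set.inter_union_distrib_left, Set.Iic_union_Ioi, Set.inter_univ] at this

theorem caputoDeriv_sq_le_of_monotoneOn {α t : ℝ} (hα0 : 0 < α) (hα1 : α < 1) (ht : 0 < t)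
    {v : ℝ → ℝ} (hc : ContinuousOn v (Set.Icc 0 t))
    (hd : IntegrableOn (deriv v) (Set.Ioo 0 t)) (hm : MonotoneOn v (Set.Icc 0 t)) :
    (1 / 2) * caputoDeriv α (fun s => v s ^ 2) t ≤ v t * caputoDeriv α v t := by
  unfold caputoDeriv
  have hΓ : 0 < (Real.Gamma (1 - α))⁻¹ := inv_pos.2 (Real.Gamma_pos_of_pos (by linarith))
  rw [mul_left_comm, mul_left_comm (v t)]
  refine mul_le_mul_of_nonneg_left ?_ hΓ.le
  simp only [intervalIntegral.integral_of_le ht.le, integral_Ioc_eq_integral_Ioo]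
  set f : ℝ → ℝ := fun s => (t - s) ^ (-α) * deriv v s with hf
  have hsq : ∫ s in Set.Ioo 0 t, (t - s) ^ (-α) * deriv (fun s => v s ^ 2) s =
      2 * ∫ s in Set.Ioo 0 t, v s * f s := by
    rw [← integral_const_mul]
    refine setIntegral_congr_ae measurableSet_Ioo ?_
    filter_upwards [hm.ae_differentiableWithinAt_of_mem] with s hs hst
    have hdiff : DifferentiableAt ℝ v s :=
      (hs ⟨hst.1.le, hst.2.le⟩).differentiableAt (Icc_mem_nhds hst.1 hst.2)
    rw [(hdiff.hasDerivAt.fun_pow 2).deriv]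
    simp only [hf]
    push_cast
    ring
  rw [hsq, ← mul_assoc, one_div, inv_mul_cancel₀ two_ne_zero, one_mul]
  have hf0 : ∀ s ∈ Set.Ioo 0 t, 0 ≤ f s := fun s hs => by
    refine mul_nonneg (Real.rpow_nonneg (by linarith [hs.2]) _) ?_
    rw [← derivWithin_of_mem_nhds (Icc_mem_nhds hs.1 hs.2)]
    exact hm.derivWithin_nonneg
  have hvle : ∀ s ∈ Set.Ioo 0 t, v s ≤ v t := fun s hs =>
    hm ⟨hs.1.le, hs.2.le⟩ ⟨ht.le, le_rfl⟩ hs.2.le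
  by_cases hfi : IntegrableOn f (Set.Ioo 0 t)
  · obtain ⟨C, hC⟩ := isCompact_Icc.exists_bound_of_continuousOn hc
    have hvf : IntegrableOn (fun s => v s * f s) (Set.Ioo 0 t) := by
      refine Integrable.bdd_mul (c := C) hfi
        ((hc.mono Set.Ioo_subset_Icc_self).aestronglyMeasurable measurableSet_Ioo) ?_
      exact (ae_restrict_iff' measurableSet_Ioo).2
        (.of_forall fun s hs => hC s (Set.Ioo_subset_Icc_self hs))
    rw [← integral_const_mul]
    exact setIntegral_mono_on hvf (hfi.const_mul _) measurableSet_Ioo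
      fun s hs => mul_le_mul_of_nonneg_right (hvle s hs) (hf0 s hs)
  · rw [integral_undef hfi, mul_zero]
    rcases le_or_gt (v t) 0 with hvt | hvt
    · exact setIntegral_nonpos measurableSet_Ioo fun s hs =>
        mul_nonpos_of_nonpos_of_nonneg ((hvle s hs).trans hvt) (hf0 s hs)
    · exact (integral_undef fun hi =>
        hfi (integrableOn_kernel_mul_of_mul hα0 ht hc hd hvt hi)).le

theorem caputoDeriv_neg (α : ℝ) (u : ℝ → ℝ) (t : ℝ) :
    caputoDeriv α (-u) t = -caputoDeriv α u t := by
  simp [caputoDeriv, deriv.neg]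

/-- `v(t)·D^α v(t) ≥ (1/2)·D^α(v²)(t)` for monotone `v`. -/
theorem caputoDeriv_sq_le (α T : ℝ) (hα0 : 0 < α) (hα1 : α < 1) (hT : 0 < T)
    (v : ℝ → ℝ) (hc : ContinuousOn v (Set.Icc 0 T))
    (hd : IntegrableOn (deriv v) (Set.Ioo 0 T))
    (hm : MonotoneOn v (Set.Icc 0 T) ∨ AntitoneOn v (Set.Icc 0 T)) :
    ∀ t ∈ Set.Ioc (0:ℝ) T,
      (1 / 2) * caputoDeriv α (fun s => v s ^ 2) t ≤ v t * caputoDeriv α v t := by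
  intro t ht
  have hsub : Set.Icc 0 t ⊆ Set.Icc 0 T := Set.Icc_subset_Icc_right ht.2
  have hc' := hc.mono hsub
  have hd' := hd.mono_set (Set.Ioo_subset_Ioo_right ht.2)
  rcases hm with hm | hm
  · exact caputoDeriv_sq_le_of_monotoneOn hα0 hα1 ht.1 hc' hd' (hm.mono hsub)
  · have h := caputoDeriv_sq_le_of_monotoneOn hα0 hα1 ht.1 hc'.neg
      (by rw [deriv.neg']; exact hd'.neg) (hm.mono hsub).neg
    simpa [caputoDeriv_neg] using h
end

section
/- Let 0 < α < 1, T > 0, let n ≥ 2 be an integer, and let u : [0,T] → ℝ be continuous, nonnegative, monotone, with integrable derivative on (0,T). Then for every t ∈ (0,T], u(t)^{n−1}·D^α u(t) ≥ (1/n)·D^α(u^n)(t), where u^n denotes the pointwise n-th power of u. -/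
open MeasureTheory

/-- A function monotone or antitone on an open set is differentiable almost everywhere on it. -/
lemma ae_differentiableAt_of_monotoneOn_or_antitoneOn {u : ℝ → ℝ} {s : Set ℝ} (hs : IsOpen s)
    (hm : MonotoneOn u s ∨ AntitoneOn u s) :
    ∀ᵐ x ∂volume.restrict s, DifferentiableAt ℝ u x := by
  have hmem := ae_restrict_mem (μ := volume) hs.measurableSet
  rcases hm with hm | hm
  · filter_upwards [hm.ae_differentiableWithinAt hs.measurableSet, hmem] with x hx hxs
    exact hx.differentiableAt (hs.mem_nhds hxs)
  · filter_upwards [hm.neg.ae_differentiableWithinAt hs.measurableSet, hmem] with x hx hxs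
    simpa using (hx.differentiableAt (hs.mem_nhds hxs)).neg

/-- If `u` is continuous at the right endpoint `t` with `u t > 0`, integrability of
`u ^ m` times the Caputo integrand of `u` implies integrability of the Caputo integrand itself. -/
lemma integrableOn_rpow_mul_of_integrableOn_pow_mul {α t : ℝ} (hα : 0 ≤ α) (m : ℕ)
    {u v : ℝ → ℝ} (hc : ContinuousWithinAt u (Set.Icc 0 t) t) (hut : 0 < u t)
    (hv : IntegrableOn v (Set.Ioo 0 t))
    (h : IntegrableOn (fun s => u s ^ m * ((t - s) ^ (-α) * v s)) (Set.Ioo 0 t)) :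
    IntegrableOn (fun s => (t - s) ^ (-α) * v s) (Set.Ioo 0 t) := by
  obtain ⟨δ, hδ, hδu⟩ : ∃ δ > 0, ∀ s ∈ Set.Icc 0 t, |s - t| < δ → u t / 2 < u s := by
    obtain ⟨δ, hδ, H⟩ := Metric.continuousWithinAt_iff.1 hc (u t / 2) (by linarith)
    refine ⟨δ, hδ, fun s hs hst => ?_⟩
    have := abs_lt.1 (by simpa [Real.dist_eq] using H hs (by simpa [Real.dist_eq] using hst))
    linarith [this.1]
  have hmeas : AEStronglyMeasurable (fun s => (t - s) ^ (-α) * v s)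
      (volume.restrict (Set.Ioo 0 t)) :=
    (by fun_prop : Measurable fun s : ℝ => (t - s) ^ (-α)).aestronglyMeasurable.mul
      hv.aestronglyMeasurable
  refine Integrable.mono' ((hv.norm.const_mul (δ ^ (-α))).add
    (h.norm.const_mul (((u t / 2) ^ m)⁻¹))) hmeas ?_
  filter_upwards [ae_restrict_mem measurableSet_Ioo] with s hs
  simp only [Pi.add_apply, norm_mul, Real.norm_eq_abs]
  have hk : 0 ≤ (t - s) ^ (-α) := Real.rpow_nonneg (by linarith [hs.2]) _
  rw [abs_of_nonneg hk]
  by_cases hst : |s - t| < δ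
  · have hus := hδu s ⟨hs.1.le, hs.2.le⟩ hst
    have hpow : (u t / 2) ^ m ≤ |u s ^ m| :=
      (pow_le_pow_left₀ (by linarith) hus.le m).trans (le_abs_self _)
    have hp : 0 < (u t / 2) ^ m := by positivity
    have h1 : (t - s) ^ (-α) * |v s|
        ≤ ((u t / 2) ^ m)⁻¹ * (|u s ^ m| * ((t - s) ^ (-α) * |v s|)) := by
      rw [← mul_assoc]
      refine le_mul_of_one_le_left (by positivity) ?_
      rw [inv_mul_eq_div]
      exact (one_le_div hp).2 hpow
    have h2 : 0 ≤ δ ^ (-α) * |v s| := by positivity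
    linarith
  · have hle : δ ≤ t - s := by
      rw [abs_sub_comm, abs_of_pos (by linarith [hs.2])] at hst
      linarith
    have h1 : (t - s) ^ (-α) ≤ δ ^ (-α) :=
      Real.rpow_le_rpow_of_nonpos hδ hle (by linarith)
    have h2 : (t - s) ^ (-α) * |v s| ≤ δ ^ (-α) * |v s| := by gcongr
    have h3 : 0 ≤ ((u t / 2) ^ m)⁻¹ * (|u s ^ m| * ((t - s) ^ (-α) * |v s|)) := by positivity
    linarith

/-- `u(t)^{n−1}·D^α u(t) ≥ (1/n)·D^α(u^n)(t)` for nonnegative monotone `u` and `n ≥ 2`. -/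
theorem caputoDeriv_pow_le (α T : ℝ) (hα0 : 0 < α) (hα1 : α < 1) (hT : 0 < T)
    (n : ℕ) (hn : 2 ≤ n)
    (u : ℝ → ℝ) (hc : ContinuousOn u (Set.Icc 0 T))
    (hpos : ∀ t ∈ Set.Icc (0:ℝ) T, 0 ≤ u t)
    (hm : MonotoneOn u (Set.Icc 0 T) ∨ AntitoneOn u (Set.Icc 0 T))
    (hd : IntegrableOn (deriv u) (Set.Ioo 0 T)) :
    ∀ t ∈ Set.Ioc (0:ℝ) T,
      (1 / (n : ℝ)) * caputoDeriv α (fun s => u s ^ n) t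
        ≤ u t ^ (n - 1) * caputoDeriv α u t := by
  rintro t ⟨ht0, htT⟩
  have hsubI : Set.Icc 0 t ⊆ Set.Icc 0 T := Set.Icc_subset_Icc_right htT
  have hsub : Set.Ioo 0 t ⊆ Set.Icc 0 T := Set.Ioo_subset_Icc_self.trans hsubI
  have htI : t ∈ Set.Icc 0 T := ⟨ht0.le, htT⟩
  have hdt : IntegrableOn (deriv u) (Set.Ioo 0 t) := hd.mono_set (Set.Ioo_subset_Ioo_right htT)
  have hmt : MonotoneOn u (Set.Ioo 0 t) ∨ AntitoneOn u (Set.Ioo 0 t) :=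
    hm.imp (·.mono hsub) (·.mono hsub)
  have hmem := ae_restrict_mem (μ := volume) (measurableSet_Ioo (a := (0 : ℝ)) (b := t))
  have hn0 : (n : ℝ) ≠ 0 := by positivity
  set f : ℝ → ℝ := fun s => (t - s) ^ (-α) * deriv u s with hf
  have hpow : (1 / (n : ℝ)) * ∫ s in (0:ℝ)..t, (t - s) ^ (-α) * deriv (fun s => u s ^ n) s
      = ∫ s in Set.Ioo 0 t, u s ^ (n - 1) * f s := by
    rw [intervalIntegral.integral_of_le ht0.le, integral_Ioc_eq_integral_Ioo,
      ← integral_const_mul]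
    refine integral_congr_ae ?_
    filter_upwards [ae_differentiableAt_of_monotoneOn_or_antitoneOn isOpen_Ioo hmt] with s hs
    simp only [hf, deriv_fun_pow hs]
    field_simp
  have hu : ∫ s in (0:ℝ)..t, (t - s) ^ (-α) * deriv u s = ∫ s in Set.Ioo 0 t, f s := by
    rw [intervalIntegral.integral_of_le ht0.le, integral_Ioc_eq_integral_Ioo]
  have hsign (s : ℝ) (hs : s ∈ Set.Ioo 0 t) :
      (u s ≤ u t ∧ 0 ≤ f s) ∨ (u t ≤ u s ∧ f s ≤ 0) := by
    have hk : 0 ≤ (t - s) ^ (-α) := Real.rpow_nonneg (by linarith [hs.2]) _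
    have hder := derivWithin_of_isOpen (f := u) isOpen_Ioo hs
    rcases hm with hm | hm
    · exact .inl ⟨hm (hsub hs) htI hs.2.le,
        mul_nonneg hk (hder ▸ (hm.mono hsub).derivWithin_nonneg)⟩
    · exact .inr ⟨hm (hsub hs) htI hs.2.le,
        mul_nonpos_of_nonneg_of_nonpos hk (hder ▸ (hm.mono hsub).derivWithin_nonpos)⟩
  have key : ∫ s in Set.Ioo 0 t, u s ^ (n - 1) * f s
      ≤ u t ^ (n - 1) * ∫ s in Set.Ioo 0 t, f s := by
    by_cases hfi : IntegrableOn f (Set.Ioo 0 t)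
    · have hgi : IntegrableOn (fun s => u s ^ (n - 1) * f s) (Set.Ioo 0 t) :=
        IntegrableOn.continuousOn_mul_of_subset ((hc.mono hsubI).pow (n - 1)) hfi isCompact_Icc
          measurableSet_Ioo Set.Ioo_subset_Icc_self
      rw [← integral_const_mul]
      refine integral_mono_ae hgi (hfi.const_mul _) ?_
      filter_upwards [hmem] with s hs
      rcases hsign s hs with ⟨h1, h2⟩ | ⟨h1, h2⟩
      · exact mul_le_mul_of_nonneg_right (pow_le_pow_left₀ (hpos s (hsub hs)) h1 _) h2
      · exact mul_le_mul_of_nonpos_right (pow_le_pow_left₀ (hpos t htI) h1 _) h2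
    · rw [integral_undef hfi, mul_zero]
      rcases (hpos t htI).eq_or_lt with hut | hut
      · refine integral_nonpos_of_ae ?_
        filter_upwards [hmem] with s hs
        have hus := hpos s (hsub hs)
        rcases hsign s hs with ⟨h1, h2⟩ | ⟨h1, h2⟩
        · have : u s = 0 := by linarith
          simp [this, show n - 1 ≠ 0 by omega]
        · exact mul_nonpos_of_nonneg_of_nonpos (by positivity) h2
      · refine (integral_undef fun hgi => hfi ?_).le
        exact integrableOn_rpow_mul_of_integrableOn_pow_mul hα0.le (n - 1)
          ((hc.mono hsubI) t ⟨ht0.le, le_rfl⟩) hut hdt hgi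
  have hΓ : 0 ≤ (Real.Gamma (1 - α))⁻¹ :=
    inv_nonneg.2 (Real.Gamma_pos_of_pos (by linarith)).le
  calc (1 / (n : ℝ)) * caputoDeriv α (fun s => u s ^ n) t
      = (Real.Gamma (1 - α))⁻¹ * ∫ s in Set.Ioo 0 t, u s ^ (n - 1) * f s := by
        rw [← hpow, caputoDeriv]; ring
    _ ≤ (Real.Gamma (1 - α))⁻¹ * (u t ^ (n - 1) * ∫ s in Set.Ioo 0 t, f s) := by gcongr
    _ = u t ^ (n - 1) * caputoDeriv α u t := by
        rw [← hu, caputoDeriv]; ring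
end

section
/- Let 0 < α < 1 and w > 0. Then there exists a constant C > 0 such that for all t > 0, E_α(w·t^α) = E_{α,1}(w·t^α) ≤ C·exp(w^{1/α}·t). -/
/-- A Gautschi-type lower bound for `Γ(n + 1 + θ)` by log-convexity. -/
theorem factorial_succ_le_Gamma_mul_rpow (n : ℕ) {θ : ℝ} (h0 : 0 ≤ θ) (h1 : θ < 1) :
    ((n + 1).factorial : ℝ) ≤ Real.Gamma (n + θ + 1) * (n + θ + 1) ^ (1 - θ) := by
  have hpos : (0 : ℝ) < n + θ + 1 := by positivity
  have hΓ := Real.Gamma_pos_of_pos hpos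
  rcases h0.eq_or_lt with rfl | h0
  · simp [Real.Gamma_nat_eq_factorial, Nat.factorial_succ, mul_comm]
  · have h := Real.Gamma_mul_add_mul_le_rpow_Gamma_mul_rpow_Gamma hpos
      (add_pos hpos one_pos) h0 (sub_pos.2 h1) (by ring)
    rw [Real.Gamma_add_one hpos.ne', Real.mul_rpow hpos.le hΓ.le] at h
    have e : θ * (n + θ + 1) + (1 - θ) * (n + θ + 1 + 1) = ((n + 1 : ℕ) : ℝ) + 1 := by
      push_cast; ring
    rw [e, Real.Gamma_nat_eq_factorial] at h
    refine h.trans_eq ?_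
    rw [mul_left_comm, ← Real.rpow_add hΓ]
    simp [mul_comm]

/-- The interpolated exponential terms are dominated by the two neighbouring integer terms. -/
theorem rpow_div_Gamma_le {x s : ℝ} (hx : 0 < x) (hs : 0 ≤ s) :
    x ^ s / Real.Gamma (s + 1) ≤
      x ^ (⌊s⌋₊ + 1) / (⌊s⌋₊ + 1).factorial + 2 * (x ^ ⌊s⌋₊ / (⌊s⌋₊).factorial) := by
  have hle := Nat.floor_le hs
  have hlt := Nat.lt_floor_add_one s
  generalize ⌊s⌋₊ = n at hle hlt ⊢
  obtain ⟨θ, rfl⟩ : ∃ θ : ℝ, s = n + θ := ⟨s - n, by ring⟩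
  have h0 : 0 ≤ θ := by linarith
  have h1 : θ < 1 := by linarith
  have hpos : (0 : ℝ) < n + θ + 1 := by positivity
  have hΓ := Real.Gamma_pos_of_pos hpos
  have hG := factorial_succ_le_Gamma_mul_rpow n h0 h1
  have hA : x ^ θ * ((n : ℝ) + θ + 1) ^ (1 - θ) ≤ x + (n + 2) := by
    refine (Real.geom_mean_le_arith_mean2_weighted h0 (sub_nonneg.2 h1.le) hx.le hpos.le
      (by ring)).trans ?_
    nlinarith
  have hB : x ^ ((n : ℝ) + θ) / Real.Gamma (n + θ + 1) ≤
      x ^ n * (x + (n + 2)) / (n + 1).factorial := by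
    rw [div_le_div_iff₀ hΓ (by positivity), Real.rpow_add hx, Real.rpow_natCast]
    calc x ^ n * x ^ θ * ((n + 1).factorial : ℝ)
        ≤ x ^ n * x ^ θ * (Real.Gamma (n + θ + 1) * (n + θ + 1) ^ (1 - θ)) := by gcongr
      _ = x ^ n * (x ^ θ * (n + θ + 1) ^ (1 - θ)) * Real.Gamma (n + θ + 1) := by ring
      _ ≤ x ^ n * (x + (n + 2)) * Real.Gamma (n + θ + 1) := by gcongr
  refine hB.trans ?_
  have hf : (0 : ℝ) < n.factorial := by positivity
  rw [mul_add, add_div, ← pow_succ]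
  gcongr
  rw [Nat.factorial_succ, Nat.cast_mul, ← mul_div_assoc,
    div_le_div_iff₀ (by positivity) (by positivity)]
  push_cast
  have : 0 ≤ x ^ n * n.factorial * n := by positivity
  linarith

/-- At most `N` multiples of `α` share an integer part, if `N * α ≥ 1`. -/
theorem card_filter_floor_mul_eq_le {α : ℝ} (hα : 0 < α) {N : ℕ} (hN : 1 ≤ α * N)
    (s : Finset ℕ) (n : ℕ) : (s.filter fun k : ℕ => ⌊α * (k : ℝ)⌋₊ = n).card ≤ N := by
  have hN0 : 0 < N := Nat.pos_of_ne_zero (by rintro rfl; norm_num at hN)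
  have key : ∀ a b : ℕ, ⌊α * (a : ℝ)⌋₊ = ⌊α * (b : ℝ)⌋₊ → a % N = b % N → ¬ a < b := by
    intro a b hab hmod hlt
    have hle : a + N ≤ b := by
      have hd : N ∣ b - a := (Nat.modEq_iff_dvd' hlt.le).1 hmod
      have := Nat.le_of_dvd (by omega) hd
      omega
    have hle' : (a : ℝ) + N ≤ b := by exact_mod_cast hle
    have h1 : α * (a : ℝ) + 1 ≤ α * b := by nlinarith
    have h2 := Nat.floor_le_floor h1
    rw [Nat.floor_add_one (by positivity)] at h2
    omega
  have hcard := Finset.card_le_card_of_injOn (s := s.filter fun k : ℕ => ⌊α * (k : ℝ)⌋₊ = n)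
    (t := Finset.range N) (fun k => k % N)
    (fun k _ => by simpa using Nat.mod_lt k hN0) (by
      intro a ha b hb hab
      simp only [Finset.coe_filter, Set.mem_ofPred_eq] at ha hb
      have hfl := ha.2.trans hb.2.symm
      have h₁ := key a b hfl hab
      have h₂ := key b a hfl.symm hab.symm
      omega)
  simpa using hcard

theorem sum_rpow_div_Gamma_le {α x : ℝ} (hα : 0 < α) (hx : 0 < x) {N : ℕ} (hN : 1 ≤ α * N)
    (s : Finset ℕ) :
    ∑ k ∈ s, x ^ (α * (k : ℝ)) / Real.Gamma (α * k + 1) ≤ 3 * N * Real.exp x := by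
  have hsum := Real.summable_pow_div_factorial x
  have htsum : ∑' n : ℕ, x ^ n / n.factorial = Real.exp x := by
    rw [Real.exp_eq_exp_ℝ, NormedSpace.exp_eq_tsum_div]
  set g : ℕ → ℝ := fun n => x ^ (n + 1) / (n + 1).factorial + 2 * (x ^ n / n.factorial) with hg
  have hg0 : ∀ n, 0 ≤ g n := fun n => by positivity
  have hgs : Summable g := ((summable_nat_add_iff 1).2 hsum).add (hsum.mul_left 2)
  have hgt : ∑' n, g n ≤ 3 * Real.exp x := by
    rw [Summable.tsum_add ((summable_nat_add_iff 1).2 hsum) (hsum.mul_left 2), tsum_mul_left,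
      htsum]
    have h := hsum.tsum_eq_zero_add
    rw [htsum] at h
    simp only [pow_zero, Nat.factorial_zero, Nat.cast_one, div_one] at h
    linarith
  calc ∑ k ∈ s, x ^ (α * (k : ℝ)) / Real.Gamma (α * k + 1)
      ≤ ∑ k ∈ s, g ⌊α * (k : ℝ)⌋₊ :=
        Finset.sum_le_sum fun k _ => rpow_div_Gamma_le hx (by positivity)
    _ = ∑ n ∈ s.image fun k : ℕ => ⌊α * (k : ℝ)⌋₊,
          (s.filter fun k : ℕ => ⌊α * (k : ℝ)⌋₊ = n).card • g n := Finset.sum_comp _ _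
    _ ≤ ∑ n ∈ s.image fun k : ℕ => ⌊α * (k : ℝ)⌋₊, N * g n := by
        refine Finset.sum_le_sum fun n _ => ?_
        rw [nsmul_eq_mul]
        exact mul_le_mul_of_nonneg_right
          (by exact_mod_cast card_filter_floor_mul_eq_le hα hN s n) (hg0 n)
    _ = N * ∑ n ∈ s.image fun k : ℕ => ⌊α * (k : ℝ)⌋₊, g n := (Finset.mul_sum ..).symm
    _ ≤ N * (3 * Real.exp x) := by
        gcongr
        exact (hgs.sum_le_tsum _ fun n _ => hg0 n).trans hgt
    _ = 3 * N * Real.exp x := by ring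

/-- For `0 < α < 1` and `w > 0` there is `C > 0` with
`E_{α,1}(w t^α) ≤ C·exp(w^{1/α} t)` for all `t > 0`. -/
theorem mittagLeffler_exp_bound (α w : ℝ) (hα0 : 0 < α) (hα1 : α < 1) (hw : 0 < w) :
    ∃ C : ℝ, 0 < C ∧ ∀ t : ℝ, 0 < t →
      mittagLeffler α 1 (w * t ^ α) ≤ C * Real.exp (w ^ (1 / α) * t) := by
  obtain ⟨N, hN⟩ := exists_nat_ge (1 / α)
  have hN' : 1 ≤ α * N := by rwa [div_le_iff₀' hα0] at hN
  have hN0 : (0 : ℝ) < N := (by positivity : 0 < 1 / α).trans_le hN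
  refine ⟨3 * N, by positivity, fun t ht => ?_⟩
  have hx : 0 < w ^ (1 / α) * t := by positivity
  have hz : w * t ^ α = (w ^ (1 / α) * t) ^ α := by
    rw [Real.mul_rpow (by positivity) ht.le, ← Real.rpow_mul hw.le, one_div_mul_cancel hα0.ne',
      Real.rpow_one]
  refine tsum_le_of_sum_le' (by positivity) fun s => ?_
  simp_rw [hz, ← Real.rpow_mul_natCast hx.le]
  exact sum_rpow_div_Gamma_le hα0 hx hN' s
end

section
/- Fractional Sobolev inequality: let N ≥ 1, 0 < s < 1 and p > 1 with sp < N, and set p_s* = pN/(N−sp). Then there exists a positive constant S = S(N,s,p) such that for all smooth compactly supported functions v : ℝ^N → ℝ, ∫_{ℝ^N}∫_{ℝ^N} |v(x)−v(y)|^p / |x−y|^{N+sp} dx dy ≥ S·(∫_{ℝ^N} |v(x)|^{p_s*} dx)^{p/p_s*}. -/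
open MeasureTheory

section FractionalSobolev

open Module Metric Set

variable {E : Type*} [NormedAddCommGroup E] [NormedSpace ℝ E] [FiniteDimensional ℝ E]
  [MeasurableSpace E] [BorelSpace E]

/-- The truncated Gagliardo kernel is integrable. -/
lemma integrable_min_one_norm_rpow_div [Nontrivial E] (μ : Measure E) [μ.IsAddHaarMeasure]
    {p σ : ℝ} (hσ : 0 < σ) (hσp : σ < p) :
    Integrable (fun z : E => min 1 ‖z‖ ^ p / ‖z‖ ^ ((finrank ℝ E : ℝ) + σ)) μ := by
  rw [integrable_fun_norm_addHaar μ
    (f := fun r => min 1 r ^ p / r ^ ((finrank ℝ E : ℝ) + σ))]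
  have hd : 1 ≤ finrank ℝ E := finrank_pos
  have hcast : ((finrank ℝ E - 1 : ℕ) : ℝ) = (finrank ℝ E : ℝ) - 1 := by
    push_cast [hd]; ring
  rw [← Ioc_union_Ioi_eq_Ioi (zero_le_one' ℝ)]
  refine IntegrableOn.union ?_ ?_
  · have h : IntegrableOn (fun r : ℝ => r ^ (p - 1 - σ)) (Ioc 0 1) volume := by
      rw [← intervalIntegrable_iff_integrableOn_Ioc_of_le zero_le_one]
      exact intervalIntegral.intervalIntegrable_rpow' (by linarith)
    refine h.congr_fun (fun r hr => ?_) measurableSet_Ioc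
    have hr0 : 0 < r := hr.1
    simp only [smul_eq_mul]
    rw [min_eq_right hr.2, ← Real.rpow_natCast, hcast, ← Real.rpow_sub hr0,
      ← Real.rpow_add hr0]
    congr 1; ring
  · have h : IntegrableOn (fun r : ℝ => r ^ (-1 - σ)) (Ioi 1) volume :=
      integrableOn_Ioi_rpow_of_lt (by linarith) zero_lt_one
    refine h.congr_fun (fun r hr => ?_) measurableSet_Ioi
    have hr1 : 1 < r := hr
    have hr0 : 0 < r := by linarith
    simp only [smul_eq_mul]
    rw [min_eq_left hr1.le, Real.one_rpow, ← Real.rpow_natCast, hcast, one_div,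
      ← Real.rpow_neg hr0.le, ← Real.rpow_add hr0]
    congr 1; ring

/-- The Gagliardo integrand of a compactly supported Lipschitz function is integrable. -/
lemma LipschitzWith.integrable_gagliardo [Nontrivial E] (μ : Measure E) [μ.IsAddHaarMeasure]
    {p σ : ℝ} (hσ : 0 < σ) (hσp : σ < p) {v : E → ℝ} {C : NNReal}
    (hv : LipschitzWith C v) (hc : HasCompactSupport v) :
    Integrable (fun z : E × E => |v z.1 - v z.2| ^ p / ‖z.1 - z.2‖ ^ ((finrank ℝ E : ℝ) + σ))
      (μ.prod μ) := by
  have hp : 0 < p := hσ.trans hσp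
  obtain ⟨M, hM⟩ := hc.exists_bound_of_continuous hv.continuous
  have hM0 : 0 ≤ M := (norm_nonneg _).trans (hM 0)
  set D : ℝ := max C (2 * M)
  have hD0 : 0 ≤ D := le_max_of_le_left C.2
  have hdiff (x y : E) : |v x - v y| ≤ D * min 1 ‖x - y‖ := by
    rw [mul_min_of_nonneg _ _ hD0, mul_one]
    refine le_min ?_ ?_
    · calc |v x - v y| ≤ |v x| + |v y| := abs_sub _ _
        _ ≤ 2 * M := by
          have h1 := hM x
          have h2 := hM y
          rw [Real.norm_eq_abs] at h1 h2
          linarith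
        _ ≤ D := le_max_right _ _
    · calc |v x - v y| ≤ C * ‖x - y‖ := by
            simpa [dist_eq_norm] using hv.dist_le_mul x y
        _ ≤ D * ‖x - y‖ := by gcongr; exact le_max_left _ _
  set G : E → ℝ := fun z => min 1 ‖z‖ ^ p / ‖z‖ ^ ((finrank ℝ E : ℝ) + σ)
  have hK : Integrable ((tsupport v).indicator (fun _ => (1 : ℝ))) μ :=
    (integrable_indicator_iff (isClosed_tsupport v).measurableSet).2
      (integrableOn_const (hs := hc.measure_lt_top.ne))
  have h₁ := hK.convolution_integrand (ContinuousLinearMap.mul ℝ ℝ)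
    (integrable_min_one_norm_rpow_div μ hσ hσp)
  have hdom := (h₁.add h₁.swap).const_mul (D ^ p)
  refine hdom.mono' ?_ (Filter.Eventually.of_forall ?_)
  · have hm := hv.continuous.measurable
    exact Measurable.aestronglyMeasurable (by fun_prop)
  · rintro ⟨x, y⟩
    rw [Real.norm_of_nonneg (by positivity)]
    simp only [Pi.add_apply, Function.comp_apply, Prod.swap, ContinuousLinearMap.mul_apply',
      norm_sub_rev y x]
    change _ ≤ D ^ p * (_ * G (x - y) + _ * G (x - y))
    by_cases hxy : x ∉ tsupport v ∧ y ∉ tsupport v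
    · rw [image_eq_zero_of_notMem_tsupport hxy.1, image_eq_zero_of_notMem_tsupport hxy.2]
      simp [hxy.1, hxy.2, Real.zero_rpow hp.ne']
    · have hone : 1 ≤ (tsupport v).indicator (fun _ => (1 : ℝ)) y
          + (tsupport v).indicator (fun _ => (1 : ℝ)) x := by
        by_cases hx : x ∈ tsupport v <;> by_cases hy : y ∈ tsupport v <;> simp_all
      rw [← add_mul]
      calc |v x - v y| ^ p / ‖x - y‖ ^ ((finrank ℝ E : ℝ) + σ)
          ≤ (D * min 1 ‖x - y‖) ^ p / ‖x - y‖ ^ ((finrank ℝ E : ℝ) + σ) := by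
            gcongr; exact hdiff x y
        _ = D ^ p * (1 * G (x - y)) := by
            rw [Real.mul_rpow hD0 (by positivity), one_mul, mul_div_assoc]
        _ ≤ _ := by
            gcongr

/-- Pointwise bound of a power of `|v x|` by the Gagliardo integral based at `x`. -/
lemma rpow_abs_le_gagliardo [Nontrivial E] (μ : Measure E) [μ.IsAddHaarMeasure]
    {p q σ : ℝ} (hp : 0 < p) (hq : 0 < q) (hσ : 0 < σ) {v : E → ℝ} (hv : Measurable v)
    (hint : Integrable (fun y => |v y| ^ q) μ) (hpos : 0 < ∫ y, |v y| ^ q ∂μ) {x : E}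
    (hx : Integrable (fun y => |v x - v y| ^ p / ‖x - y‖ ^ ((finrank ℝ E : ℝ) + σ)) μ) :
    (1 / 2) ^ p * (μ.real (ball (0 : E) 1) / 2) * |v x| ^ (p + q * σ / finrank ℝ E) ≤
      (2 * 2 ^ q / μ.real (ball (0 : E) 1)) ^ (σ / finrank ℝ E) *
        (∫ y, |v y| ^ q ∂μ) ^ (σ / finrank ℝ E) *
        ∫ y, |v x - v y| ^ p / ‖x - y‖ ^ ((finrank ℝ E : ℝ) + σ) ∂μ := by
  have hd : (0 : ℝ) < finrank ℝ E := by exact_mod_cast finrank_pos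
  set d : ℝ := (finrank ℝ E : ℝ)
  set ω := μ.real (ball (0 : E) 1)
  set I := ∫ y, |v y| ^ q ∂μ
  have hω : 0 < ω := ENNReal.toReal_pos (measure_ball_pos _ _ one_pos).ne' measure_ball_lt_top.ne
  have hU : 0 ≤ ∫ y, |v x - v y| ^ p / ‖x - y‖ ^ (d + σ) ∂μ :=
    integral_nonneg fun y => by positivity
  rcases (abs_nonneg (v x)).eq_or_lt with ht | ht
  · rw [← ht, Real.zero_rpow (by positivity)]
    simp only [mul_zero]
    positivity
  set t := |v x| with ht_def
  set R : ℝ := 2 * 2 ^ q / ω * I * (t ^ q)⁻¹ with hR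
  have hR0 : 0 < R := by positivity
  set r : ℝ := R ^ (1 / d) with hr
  have hr0 : 0 < r := by positivity
  have hrd : r ^ d = R := by rw [hr, ← Real.rpow_mul hR0.le]; field_simp; simp
  have hball : μ.real (ball x r) = R * ω := by
    rw [measureReal_def, Measure.addHaar_ball μ x hr0.le, ENNReal.toReal_mul,
      ENNReal.toReal_ofReal (by positivity), ← Real.rpow_natCast, hrd]
    rfl
  set B : Set E := {y | (t / 2) ^ q ≤ |v y| ^ q}
  have hcheb : (t / 2) ^ q * μ.real B ≤ I :=
    mul_meas_ge_le_integral_of_nonneg (Filter.Eventually.of_forall fun y => by positivity) hint _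
  have hBfin : μ B ≠ ⊤ := (hint.measure_ge_lt_top (by positivity)).ne
  have hBle : μ.real B ≤ R * ω / 2 := by
    rw [mul_comm, ← le_div_iff₀ (by positivity)] at hcheb
    refine hcheb.trans_eq ?_
    rw [hR, Real.div_rpow ht.le zero_le_two]
    field_simp
  have hBm : MeasurableSet B :=
    measurableSet_le measurable_const (by fun_prop)
  set A : Set E := ball x r \ B
  have hAm : MeasurableSet A := measurableSet_ball.diff hBm
  have hAge : R * ω / 2 ≤ μ.real A := by
    have := le_measureReal_sdiff (μ := μ) (s₁ := ball x r) (s₂ := B) hBfin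
    linarith
  have hAfin : μ A ≠ ⊤ := measure_ne_top_of_subset sdiff_subset measure_ball_lt_top.ne
  have hlow : (t / 2) ^ p / r ^ (d + σ) * μ.real A ≤
      ∫ y, |v x - v y| ^ p / ‖x - y‖ ^ (d + σ) ∂μ := by
    refine (setIntegral_ge_of_const_le_real hAm hAfin (fun y hy => ?_) hx.integrableOn).trans
      (setIntegral_le_integral hx (Filter.Eventually.of_forall fun y => by positivity))
    have hyt : |v y| < t / 2 := by
      have : ¬ (t / 2) ^ q ≤ |v y| ^ q := hy.2
      by_contra! h
      exact this (Real.rpow_le_rpow (by positivity) h hq.le)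
    have hdist : t / 2 ≤ |v x - v y| := by
      have := abs_sub_abs_le_abs_sub (v x) (v y)
      linarith
    have hxy : 0 < ‖x - y‖ := by
      rw [norm_sub_pos_iff]
      rintro rfl
      rw [← ht_def] at hyt
      linarith
    have hyr : ‖x - y‖ ≤ r := by
      have := hy.1
      rw [mem_ball', dist_eq_norm] at this
      exact this.le
    gcongr
  have hrσ : r ^ σ = (2 * 2 ^ q / ω) ^ (σ / d) * I ^ (σ / d) * (t ^ (q * σ / d))⁻¹ := by
    rw [hr, ← Real.rpow_mul hR0.le, hR, Real.mul_rpow (by positivity) (by positivity),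
      Real.mul_rpow (by positivity) (by positivity), Real.inv_rpow (by positivity),
      ← Real.rpow_mul ht.le]
    ring_nf
  have key : (t / 2) ^ p * (ω / 2) ≤
      r ^ σ * ∫ y, |v x - v y| ^ p / ‖x - y‖ ^ (d + σ) ∂μ := by
    calc (t / 2) ^ p * (ω / 2) = r ^ σ * ((t / 2) ^ p / r ^ (d + σ) * (R * ω / 2)) := by
          rw [Real.rpow_add hr0, hrd]
          field_simp
      _ ≤ r ^ σ * ((t / 2) ^ p / r ^ (d + σ) * μ.real A) := by gcongr
      _ ≤ _ := by gcongr
  rw [hrσ] at key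
  calc (1 / 2) ^ p * (ω / 2) * t ^ (p + q * σ / d)
      = t ^ (q * σ / d) * ((t / 2) ^ p * (ω / 2)) := by
        rw [Real.rpow_add ht, div_eq_mul_one_div t 2, Real.mul_rpow ht.le (by norm_num)]
        ring
    _ ≤ t ^ (q * σ / d) * ((2 * 2 ^ q / ω) ^ (σ / d) * I ^ (σ / d) * (t ^ (q * σ / d))⁻¹ *
          ∫ y, |v x - v y| ^ p / ‖x - y‖ ^ (d + σ) ∂μ) := by gcongr
    _ = _ := by field_simp

end FractionalSobolev

/-- Fractional Sobolev inequality: for `0 < s < 1`, `p > 1`, `sp < N`, there is `S > 0`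
such that `[v]_{W^{s,p}(ℝ^N)}^p ≥ S·‖v‖_{L^{p_s^*}}^p` for smooth compactly supported `v`,
where `p_s^* = pN/(N−sp)`. -/
theorem fractional_sobolev_inequality (N : ℕ) (hN : 1 ≤ N) (s p : ℝ)
    (hs0 : 0 < s) (hs1 : s < 1) (hp : 1 < p) (hsp : s * p < N) :
    ∃ S : ℝ, 0 < S ∧ ∀ v : EuclideanSpace ℝ (Fin N) → ℝ,
      ContDiff ℝ (⊤ : ℕ∞) v → HasCompactSupport v →
      S * (∫ x, |v x| ^ (p * N / ((N : ℝ) - s * p))) ^ (p / (p * N / ((N : ℝ) - s * p)))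
        ≤ ∫ x, ∫ y, |v x - v y| ^ p / ‖x - y‖ ^ ((N : ℝ) + s * p) := by
  have : Nonempty (Fin N) := ⟨⟨0, hN⟩⟩
  have hp0 : 0 < p := by linarith
  have hN0 : (0 : ℝ) < N := by exact_mod_cast hN
  have hσ : 0 < s * p := by positivity
  have hσp : s * p < p := by nlinarith
  have hNσ : 0 < (N : ℝ) - s * p := by linarith
  have hfin : (Module.finrank ℝ (EuclideanSpace ℝ (Fin N)) : ℝ) = N := by simp
  set q : ℝ := p * N / ((N : ℝ) - s * p) with hq
  have hq0 : 0 < q := by positivity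
  have hqp : p + q * (s * p) / N = q := by
    have hqN : q * ((N : ℝ) - s * p) = p * N := div_mul_cancel₀ _ hNσ.ne'
    have hdiv : q * (s * p) / N = q - p := by
      rw [div_eq_iff hN0.ne']
      linarith
    linarith
  have hpq : p / q = 1 - s * p / N := by rw [hq]; field_simp
  set ω := volume.real (Metric.ball (0 : EuclideanSpace ℝ (Fin N)) 1)
  have hω : 0 < ω :=
    ENNReal.toReal_pos (Metric.measure_ball_pos _ _ one_pos).ne' measure_ball_lt_top.ne
  set c : ℝ := (1 / 2) ^ p * (ω / 2)
  set K : ℝ := (2 * 2 ^ q / ω) ^ (s * p / N)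
  have hc0 : 0 < c := by positivity
  have hK0 : 0 < K := by positivity
  refine ⟨c / K, by positivity, fun v hv hc => ?_⟩
  have hI0 : 0 ≤ ∫ x, |v x| ^ q := integral_nonneg fun x => by positivity
  rcases hI0.eq_or_lt with hI | hI
  · rw [← hI, Real.zero_rpow (by positivity), mul_zero]
    exact integral_nonneg fun x => integral_nonneg fun y => by positivity
  obtain ⟨C, hC⟩ := hv.lipschitzWith_of_hasCompactSupport hc (by simp)
  have hgag := hC.integrable_gagliardo volume hσ hσp hc
  have hint : Integrable (fun x => |v x| ^ q) := by
    refine Continuous.integrable_of_hasCompactSupport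
      (hv.continuous.abs.rpow_const fun _ => Or.inr hq0.le) ?_
    exact hc.comp_left (g := fun a : ℝ => |a| ^ q) (by simp [Real.zero_rpow hq0.ne'])
  have hpt : ∀ᵐ x, c * |v x| ^ q ≤ K * (∫ y, |v y| ^ q) ^ (s * p / N) *
      ∫ y, |v x - v y| ^ p / ‖x - y‖ ^ ((N : ℝ) + s * p) := by
    filter_upwards [hgag.prod_right_ae] with x hx
    have h := rpow_abs_le_gagliardo volume hp0 hq0 hσ hv.continuous.measurable hint hI hx
    rwa [hfin, hqp] at h
  rw [hfin] at hgag
  have hmain := integral_mono_ae (hint.const_mul c) (hgag.integral_prod_left.const_mul _) hpt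
  rw [integral_const_mul, integral_const_mul] at hmain
  set I := ∫ x, |v x| ^ q
  rw [hpq, Real.rpow_sub hI, Real.rpow_one, div_mul_div_comm, div_le_iff₀ (by positivity)]
  linarith
end

section
/- Let p > 1 and 0 < α < 1. Then there exist constants c₁, c₂, c₃ > 0 such that for all real numbers a, b ≥ 0: (i) (a+b)^α ≤ c₁·a^α + c₂·b^α, and (ii) |a−b|^{p−2}·(a−b)·(a^α − b^α) ≥ c₃·|a^{(p+α−1)/p} − b^{(p+α−1)/p}|^p. -/
/-- Normalized form of the second inequality, with the larger variable equal to `1`. -/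
lemma mul_one_sub_rpow_le {p α θ t : ℝ} (hp : 0 < p) (hα0 : 0 ≤ α) (hα1 : α ≤ 1)
    (hθ0 : 0 ≤ θ) (hθ1 : θ ≤ 1) (ht0 : 0 ≤ t) (ht1 : t < 1) :
    α * (1 - t ^ θ) ^ p ≤ (1 - t) ^ (p - 1) * (1 - t ^ α) := by
  have ht : 0 < 1 - t := by linarith
  have htθ : t ≤ t ^ θ := by
    rcases ht0.eq_or_lt with rfl | h
    · exact Real.rpow_nonneg le_rfl θ
    · simpa using Real.rpow_le_rpow_of_exponent_ge h ht1.le hθ1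
  have hsub : 0 ≤ 1 - t ^ θ := sub_nonneg.2 (Real.rpow_le_one ht0 ht1.le hθ0)
  have hbern : α * (1 - t) ≤ 1 - t ^ α := by
    have h := rpow_one_add_le_one_add_mul_self (s := t - 1) (by linarith) hα0 hα1
    rw [add_sub_cancel] at h
    linarith
  calc α * (1 - t ^ θ) ^ p ≤ α * (1 - t) ^ p := by gcongr
    _ = (1 - t) ^ (p - 1) * (α * (1 - t)) := by
      rw [Real.rpow_sub_one ht.ne']
      field_simp
    _ ≤ (1 - t) ^ (p - 1) * (1 - t ^ α) := by gcongr

/-- The second inequality for `b < a`, with constant `α`. -/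
lemma mul_abs_rpow_sub_rpow_le_of_lt {p α a b : ℝ} (hp : 1 < p) (hα0 : 0 < α) (hα1 : α < 1)
    (hb : 0 ≤ b) (hab : b < a) :
    α * |a ^ ((p + α - 1) / p) - b ^ ((p + α - 1) / p)| ^ p
      ≤ |a - b| ^ (p - 2) * (a - b) * (a ^ α - b ^ α) := by
  have hp0 : 0 < p := by linarith
  have ha : 0 < a := hb.trans_lt hab
  have hθ0 : 0 ≤ (p + α - 1) / p := div_nonneg (by linarith) hp0.le
  have hθ1 : (p + α - 1) / p ≤ 1 := (div_le_one hp0).2 (by linarith)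
  have hθp : (p + α - 1) / p * p = p - 1 + α := by field_simp; ring
  set θ := (p + α - 1) / p
  obtain ⟨t, rfl⟩ : ∃ t, b = a * t := ⟨b / a, by field_simp⟩
  have ht0 : 0 ≤ t := nonneg_of_mul_nonneg_right hb ha
  have ht1 : t < 1 := by nlinarith
  have hsub : 0 ≤ 1 - t ^ θ := sub_nonneg.2 (Real.rpow_le_one ht0 ht1.le hθ0)
  have hd : 0 < a - a * t := sub_pos.2 hab
  have hleft : |a ^ θ - (a * t) ^ θ| ^ p = a ^ (p - 1 + α) * (1 - t ^ θ) ^ p := by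
    rw [Real.mul_rpow ha.le ht0, ← mul_one_sub,
      abs_of_nonneg (mul_nonneg (Real.rpow_nonneg ha.le θ) hsub),
      Real.mul_rpow (Real.rpow_nonneg ha.le θ) hsub, ← Real.rpow_mul ha.le, hθp]
  have hright : |a - a * t| ^ (p - 2) * (a - a * t) * (a ^ α - (a * t) ^ α) =
      a ^ (p - 1 + α) * ((1 - t) ^ (p - 1) * (1 - t ^ α)) := by
    rw [abs_of_pos hd, ← Real.rpow_add_one hd.ne', show p - 2 + 1 = p - 1 by ring,
      Real.mul_rpow ha.le ht0, ← mul_one_sub, Real.mul_rpow ha.le (by linarith),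
      Real.rpow_add ha]
    ring
  rw [hleft, hright, mul_left_comm]
  exact mul_le_mul_of_nonneg_left
    (mul_one_sub_rpow_le hp0 hα0.le hα1.le hθ0 hθ1 ht0 ht1) (Real.rpow_nonneg ha.le _)

/-- Elementary inequalities for real powers: `(a+b)^α ≤ c₁ a^α + c₂ b^α` and
`|a−b|^{p−2}(a−b)(a^α−b^α) ≥ c₃ |a^{(p+α−1)/p} − b^{(p+α−1)/p}|^p` for `a, b ≥ 0`. -/
theorem rpow_elementary_inequalities (p α : ℝ) (hp : 1 < p) (hα0 : 0 < α) (hα1 : α < 1) :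
    ∃ c₁ : ℝ, 0 < c₁ ∧ ∃ c₂ : ℝ, 0 < c₂ ∧ ∃ c₃ : ℝ, 0 < c₃ ∧
      ∀ a b : ℝ, 0 ≤ a → 0 ≤ b →
        (a + b) ^ α ≤ c₁ * a ^ α + c₂ * b ^ α ∧
        c₃ * |a ^ ((p + α - 1) / p) - b ^ ((p + α - 1) / p)| ^ p
          ≤ |a - b| ^ (p - 2) * (a - b) * (a ^ α - b ^ α) := by
  refine ⟨1, one_pos, 1, one_pos, α, hα0, fun a b ha hb => ⟨?_, ?_⟩⟩
  · simpa using Real.rpow_add_le_add_rpow ha hb hα0.le hα1.le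
  · rcases lt_trichotomy a b with h | rfl | h
    · have key := mul_abs_rpow_sub_rpow_le_of_lt hp hα0 hα1 ha h
      rw [abs_sub_comm, abs_sub_comm a b]
      linarith
    · simp [Real.zero_rpow (by linarith : p ≠ 0)]
    · exact mul_abs_rpow_sub_rpow_le_of_lt hp hα0 hα1 hb h
end

section
/- Gagliardo–Nirenberg interpolation inequality: let N ≥ 1 and suppose q > max{1, 2N/(N+2)}, 1 ≤ r < σ and r < p < σ + 1, where σ = ((q−1)N + q)/(N − q) if q < N and σ = ∞ if q ≥ N. Set λ* = qN(p−r) / (p·[N(q−r) + qr]). Then there exists a constant C_GN > 0 such that for every smooth compactly supported function u : ℝ^N → ℝ, ‖u‖_{L^p(ℝ^N)} ≤ C_GN · ‖u‖_{L^r(ℝ^N)}^{1−λ*} · ‖∇u‖_{L^q(ℝ^N)}^{λ*}. -/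
open MeasureTheory

/-- Log-convexity of `t ↦ ∫ |f| ^ t`. -/
theorem integral_abs_rpow_le_interpolate {α : Type*} [MeasurableSpace α] {μ : Measure α}
    {f : α → ℝ} {r t a : ℝ} (hr : 0 < r) (hrt : r ≤ t) (hta : t ≤ a) (hra : r < a)
    (hf : AEStronglyMeasurable f μ) (hfr : Integrable (fun x ↦ |f x| ^ r) μ)
    (hfa : Integrable (fun x ↦ |f x| ^ a) μ) :
    ∫ x, |f x| ^ t ∂μ ≤ (∫ x, |f x| ^ r ∂μ) ^ ((a - t) / (a - r)) *
      (∫ x, |f x| ^ a ∂μ) ^ ((t - r) / (a - r)) := by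
  have hd : 0 < a - r := sub_pos.2 hra
  have hθ : 0 ≤ (a - t) / (a - r) := div_nonneg (sub_nonneg.2 hta) hd.le
  have hη : 0 ≤ (t - r) / (a - r) := div_nonneg (sub_nonneg.2 hrt) hd.le
  have hsum : (a - t) / (a - r) + (t - r) / (a - r) = 1 := by field_simp; ring
  have hpt (x : α) : ENNReal.ofReal (|f x| ^ t) =
      ENNReal.ofReal (|f x| ^ r) ^ ((a - t) / (a - r)) *
        ENNReal.ofReal (|f x| ^ a) ^ ((t - r) / (a - r)) := by
    rw [ENNReal.ofReal_rpow_of_nonneg (by positivity) hθ,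
      ENNReal.ofReal_rpow_of_nonneg (by positivity) hη, ← ENNReal.ofReal_mul (by positivity),
      ← Real.rpow_mul (abs_nonneg _), ← Real.rpow_mul (abs_nonneg _),
      ← Real.rpow_add_of_nonneg (abs_nonneg _) (by positivity)
        (mul_nonneg (hr.le.trans hra.le) hη)]
    congr 2
    field_simp
    ring
  have hR : 0 ≤ ∫ x, |f x| ^ r ∂μ := integral_nonneg fun x ↦ by positivity
  have hA : 0 ≤ ∫ x, |f x| ^ a ∂μ := integral_nonneg fun x ↦ by positivity
  have hft : AEStronglyMeasurable (fun x ↦ |f x| ^ t) μ :=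
    (hf.norm.aemeasurable.pow_const t).aestronglyMeasurable
  rw [integral_eq_lintegral_of_nonneg_ae (.of_forall fun x ↦ by positivity) hft]
  refine ENNReal.toReal_le_of_le_ofReal (by positivity) ?_
  rw [ENNReal.ofReal_mul (by positivity), ← ENNReal.ofReal_rpow_of_nonneg hR hθ,
    ← ENNReal.ofReal_rpow_of_nonneg hA hη,
    ofReal_integral_eq_lintegral_ofReal hfr (.of_forall fun x ↦ by positivity),
    ofReal_integral_eq_lintegral_ofReal hfa (.of_forall fun x ↦ by positivity)]
  simp_rw [hpt]
  exact ENNReal.lintegral_mul_norm_pow_le hfr.aemeasurable.ennreal_ofReal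
    hfa.aemeasurable.ennreal_ofReal hθ hη hsum

theorem Continuous.integrable_norm_rpow_of_hasCompactSupport {E F : Type*} [TopologicalSpace E]
    [MeasurableSpace E] [OpensMeasurableSpace E] [NormedAddCommGroup F] {μ : Measure E}
    [IsFiniteMeasureOnCompacts μ] {f : E → F} (hf : Continuous f) (hf' : HasCompactSupport f)
    {t : ℝ} (ht : 0 < t) : Integrable (fun x ↦ ‖f x‖ ^ t) μ :=
  (hf.norm.rpow_const fun _ ↦ .inr ht.le).integrable_of_hasCompactSupport
    (hf'.norm.rpow_const ht.ne')

section

variable {E : Type*} [NormedAddCommGroup E] [NormedSpace ℝ E] [MeasurableSpace E] [BorelSpace E]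
  {μ : Measure E} [IsFiniteMeasureOnCompacts μ] {u : E → ℝ} {γ q : ℝ}

theorem lintegral_enorm_fderiv_abs_rpow_le (hu : ContDiff ℝ 1 u) (hu' : HasCompactSupport u)
    (hγ : 1 < γ) (hq : 1 < q) :
    ∫⁻ x, ‖fderiv ℝ (fun y ↦ |u y| ^ γ) x‖ₑ ∂μ ≤ ENNReal.ofReal (γ *
      ((∫ x, |u x| ^ ((γ - 1) * (q / (q - 1))) ∂μ) ^ ((q - 1) / q) *
        (∫ x, ‖fderiv ℝ u x‖ ^ q ∂μ) ^ (1 / q))) := by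
  have hγ' : 0 < γ - 1 := sub_pos.2 hγ
  have hc : Continuous (fderiv ℝ u) := hu.continuous_fderiv one_ne_zero
  have hs : HasCompactSupport (fderiv ℝ u) := hu'.fderiv ℝ
  have hcu : Continuous fun x ↦ |u x| ^ (γ - 1) :=
    hu.continuous.abs.rpow_const fun _ ↦ .inr hγ'.le
  have hsu : HasCompactSupport fun x ↦ |u x| ^ (γ - 1) := hu'.norm.rpow_const hγ'.ne'
  have hint : Integrable (fun x ↦ γ * (|u x| ^ (γ - 1) * ‖fderiv ℝ u x‖)) μ :=
    ((hcu.mul hc.norm).integrable_of_hasCompactSupport hsu.mul_right).const_mul γ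
  calc ∫⁻ x, ‖fderiv ℝ (fun y ↦ |u y| ^ γ) x‖ₑ ∂μ
      ≤ ∫⁻ x, ENNReal.ofReal (γ * (|u x| ^ (γ - 1) * ‖fderiv ℝ u x‖)) ∂μ := by
        gcongr with x
        rw [← ofReal_norm, ← mul_assoc]
        exact ENNReal.ofReal_le_ofReal
          (norm_fderiv_norm_rpow_le (hu.differentiable one_ne_zero) hγ)
    _ = ENNReal.ofReal (γ * ∫ x, |u x| ^ (γ - 1) * ‖fderiv ℝ u x‖ ∂μ) := by
        rw [← ofReal_integral_eq_lintegral_ofReal hint (.of_forall fun x ↦ by positivity),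
          integral_const_mul]
    _ ≤ _ := by
        refine ENNReal.ofReal_le_ofReal (mul_le_mul_of_nonneg_left ?_ (by positivity))
        have h := integral_mul_le_Lp_mul_Lq_of_nonneg (μ := μ)
          (Real.HolderConjugate.conjExponent hq).symm
          (.of_forall fun x ↦ by positivity) (.of_forall fun x ↦ norm_nonneg _)
          (hcu.memLp_of_hasCompactSupport hsu) (hc.norm.memLp_of_hasCompactSupport hs.norm)
        simp_rw [← Real.rpow_mul (abs_nonneg _)] at h
        simpa [Real.conjExponent] using h

end

theorem exists_integral_abs_rpow_le_fderiv {N : ℕ} (hN : 2 ≤ N) {γ q : ℝ} (hγ : 1 < γ)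
    (hq : 1 < q) : ∃ C : ℝ, 0 < C ∧ ∀ u : EuclideanSpace ℝ (Fin N) → ℝ,
      ContDiff ℝ 1 u → HasCompactSupport u →
      ∫ x, |u x| ^ (γ * (N / (N - 1) : ℝ)) ≤ C *
        ((∫ x, |u x| ^ ((γ - 1) * (q / (q - 1)))) ^ ((q - 1) / q) *
          (∫ x, ‖fderiv ℝ u x‖ ^ q) ^ (1 / q)) ^ (N / (N - 1) : ℝ) := by
  have hN1 : (1 : ℝ) < N := by exact_mod_cast hN
  have hs : 0 < (N / (N - 1) : ℝ) := div_pos (by linarith) (by linarith)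
  have hconj : Real.HolderConjugate
      (Module.finrank ℝ (EuclideanSpace ℝ (Fin N)) : ℝ) (N / (N - 1) : ℝ) := by
    simpa [Real.conjExponent] using Real.HolderConjugate.conjExponent hN1
  set K := lintegralPowLePowLIntegralFDerivConst
    (volume : Measure (EuclideanSpace ℝ (Fin N))) (N / (N - 1) : ℝ)
  refine ⟨(K + 1) * γ ^ (N / (N - 1) : ℝ), by positivity, fun u hu hu' ↦ ?_⟩
  set X := (∫ x, |u x| ^ ((γ - 1) * (q / (q - 1)))) ^ ((q - 1) / q) *
          (∫ x, ‖fderiv ℝ u x‖ ^ q) ^ (1 / q)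
  have hX : 0 ≤ X := mul_nonneg
    (Real.rpow_nonneg (integral_nonneg fun x ↦ by positivity) _)
    (Real.rpow_nonneg (integral_nonneg fun x ↦ by positivity) _)
  have hv : ContDiff ℝ 1 (fun x ↦ |u x| ^ γ) := hu.norm_rpow hγ
  have hv' : HasCompactSupport (fun x ↦ |u x| ^ γ) := hu'.norm.rpow_const (by positivity)
  have h := (lintegral_pow_le_pow_lintegral_fderiv volume hv hv' hconj).trans
    (mul_le_mul_right (ENNReal.rpow_le_rpow
      (lintegral_enorm_fderiv_abs_rpow_le hu hu' hγ hq) hs.le) _)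
  rw [integral_eq_lintegral_of_nonneg_ae (.of_forall fun x ↦ by positivity)
    (hu.continuous.abs.rpow_const fun _ ↦ .inr (by positivity)).aestronglyMeasurable]
  refine ENNReal.toReal_le_of_le_ofReal (by positivity) ?_
  calc _ = ∫⁻ x, ‖|u x| ^ γ‖ₑ ^ (N / (N - 1) : ℝ) := by
        congr! 2 with x
        rw [Real.enorm_eq_ofReal (by positivity),
          ENNReal.ofReal_rpow_of_nonneg (by positivity) hs.le, Real.rpow_mul (abs_nonneg _)]
    _ ≤ _ := h
    _ = ENNReal.ofReal (K * (γ * X) ^ (N / (N - 1) : ℝ)) := by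
        rw [ENNReal.ofReal_mul K.coe_nonneg, ← ENNReal.ofReal_rpow_of_nonneg (by positivity) hs.le,
          ENNReal.ofReal_coe_nnreal]
    _ ≤ _ := by
        refine ENNReal.ofReal_le_ofReal ?_
        rw [Real.mul_rpow (by positivity) hX, ← mul_assoc]
        gcongr
        simp

theorem abs_rpow_le_fderiv_fin_one {γ q : ℝ} (hγ : 1 < γ) (hq : 1 < q)
    {u : EuclideanSpace ℝ (Fin 1) → ℝ} (hu : ContDiff ℝ 1 u) (hu' : HasCompactSupport u)
    (x : EuclideanSpace ℝ (Fin 1)) :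
    |u x| ^ γ ≤ γ * ((∫ x, |u x| ^ ((γ - 1) * (q / (q - 1)))) ^ ((q - 1) / q) *
          (∫ x, ‖fderiv ℝ u x‖ ^ q) ^ (1 / q)) := by
  have hv : ContDiff ℝ 1 (fun x ↦ |u x| ^ γ) := hu.norm_rpow hγ
  have hv' : HasCompactSupport (fun x ↦ |u x| ^ γ) := hu'.norm.rpow_const (by positivity)
  set X := (∫ x, |u x| ^ ((γ - 1) * (q / (q - 1)))) ^ ((q - 1) / q) *
          (∫ x, ‖fderiv ℝ u x‖ ^ q) ^ (1 / q)
  have hX : 0 ≤ X := mul_nonneg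
    (Real.rpow_nonneg (integral_nonneg fun x ↦ by positivity) _)
    (Real.rpow_nonneg (integral_nonneg fun x ↦ by positivity) _)
  set v := fun x ↦ |u x| ^ γ
  let e : ℝ ≃ₗᵢ[ℝ] EuclideanSpace ℝ (Fin 1) := (OrthonormalBasis.singleton (Fin 1) ℝ).repr
  have hw : ContDiff ℝ 1 (v ∘ e) := hv.comp e.contDiff
  have hw' : HasCompactSupport (v ∘ e) := hv'.comp_homeomorph e.toHomeomorph
  refine (ENNReal.ofReal_le_ofReal_iff (by positivity)).1 ?_
  calc ENNReal.ofReal (|u x| ^ γ) = ‖(v ∘ e) (e.symm x)‖ₑ := by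
        simp only [Function.comp, e.apply_symm_apply]
        exact (Real.enorm_eq_ofReal (by positivity)).symm
    _ ≤ ∫⁻ y in Set.Iic (e.symm x), ‖deriv (v ∘ e) y‖ₑ :=
        HasCompactSupport.enorm_le_lintegral_Ici_deriv hw hw' _
    _ ≤ ∫⁻ y, ‖deriv (v ∘ e) y‖ₑ := setLIntegral_le_lintegral _ _
    _ ≤ ∫⁻ y, ‖fderiv ℝ v (e y)‖ₑ := by
        gcongr with y
        have hd : HasDerivAt (v ∘ e) (fderiv ℝ v (e y) (e 1)) y :=
          ((hv.differentiable one_ne_zero) (e y)).hasFDerivAt.comp_hasDerivAt y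
            e.toContinuousLinearEquiv.toContinuousLinearMap.hasDerivAt
        rw [hd.deriv, ← ofReal_norm, ← ofReal_norm]
        refine ENNReal.ofReal_le_ofReal (((fderiv ℝ v (e y)).le_opNorm _).trans_eq ?_)
        simp
    _ = ∫⁻ y, ‖fderiv ℝ v y‖ₑ :=
        e.measurePreserving.lintegral_comp_emb e.toHomeomorph.measurableEmbedding
          fun z ↦ ‖fderiv ℝ v z‖ₑ
    _ ≤ _ := lintegral_enorm_fderiv_abs_rpow_le hu hu' hγ hq

/-- The exponent `γ` for which the `L¹` Sobolev inequality is applied to `|u| ^ γ`. -/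
theorem exists_sobolev_power {n q r p : ℝ} (hn : 1 < n) (hq : 1 < q) (hr : 0 < r) (hrp : r < p)
    (hp : q < n → p ≤ q * n / (n - q)) :
    ∃ γ : ℝ, 1 < γ ∧ r ≤ (γ - 1) * (q / (q - 1)) ∧
      (γ - 1) * (q / (q - 1)) ≤ γ * (n / (n - 1)) ∧ p ≤ γ * (n / (n - 1)) := by
  have hn' : 0 < n - 1 := sub_pos.2 hn
  have hq' : 0 < q - 1 := sub_pos.2 hq
  rcases lt_or_ge q n with h | h
  · have h' : 0 < n - q := sub_pos.2 h
    have ha : q * (n - 1) / (n - q) * (n / (n - 1)) = q * n / (n - q) := by field_simp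
    have hb : (q * (n - 1) / (n - q) - 1) * (q / (q - 1)) = q * n / (n - q) := by
      field_simp
      ring
    refine ⟨q * (n - 1) / (n - q), ?_, ?_, ?_, ?_⟩
    · rw [one_lt_div h']
      nlinarith
    · rw [hb]
      exact hrp.le.trans (hp h)
    · rw [ha, hb]
    · rw [ha]
      exact hp h
  · have h1 : 1 ≤ q / (q - 1) := by rw [one_le_div hq']; linarith
    have h2 : q / (q - 1) ≤ n / (n - 1) := by
      rw [div_le_div_iff₀ hq' hn']
      nlinarith
    refine ⟨1 + r + p, by linarith, ?_, ?_, ?_⟩ <;> nlinarith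

theorem le_rpow_mul_rpow_of_interpolation {n q r p a b C A B R G P : ℝ} (hn : 1 < n) (hq : 1 < q)
    (hr : 0 < r) (hrp : r < p) (hrb : r ≤ b) (hba : b ≤ a) (hpa : p ≤ a)
    (hab : a * ((n - 1) / n) = b * ((q - 1) / q) + 1)
    (hD : 0 < n * (q - r) + q * r) (hC : 0 < C) (hA : 0 ≤ A) (hB : 0 ≤ B) (hR : 0 ≤ R)
    (hG : 0 ≤ G) (hP : 0 ≤ P) (hAB : A ≤ C * (B ^ ((q - 1) / q) * G ^ (1 / q)) ^ (n / (n - 1)))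
    (hBR : B ≤ R ^ ((a - b) / (a - r)) * A ^ ((b - r) / (a - r)))
    (hPR : P ≤ R ^ ((a - p) / (a - r)) * A ^ ((p - r) / (a - r))) :
    P ^ (1 / p) ≤ C ^ (q * (n - 1) * (p - r) / (p * (n * (q - r) + q * r))) *
      R ^ ((1 - q * n * (p - r) / (p * (n * (q - r) + q * r))) / r) *
      G ^ ((q * n * (p - r) / (p * (n * (q - r) + q * r))) / q) := by
  have hp : 0 < p := hr.trans hrp
  have hn' : 0 < n - 1 := sub_pos.2 hn
  have hq' : 0 < q - 1 := sub_pos.2 hq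
  have hra : 0 < a - r := by linarith
  have hpr : 0 < p - r := sub_pos.2 hrp
  have hpa' : 0 ≤ a - p := sub_nonneg.2 hpa
  have hba' : 0 ≤ a - b := sub_nonneg.2 hba
  have hrb' : 0 ≤ b - r := sub_nonneg.2 hrb
  rcases hA.eq_or_lt with rfl | hA0
  · rw [Real.zero_rpow (by positivity), mul_zero] at hPR
    rw [le_antisymm hPR hP, Real.zero_rpow (by positivity)]
    positivity
  set D := n * (q - r) + q * r with hDdef
  have hab' : a * (n - 1) * q = b * (q - 1) * n + n * q := by
    field_simp at hab
    linarith
  have hA1 : A ≤ C * (R ^ ((a - b) / (a - r) * ((q - 1) / q) * (n / (n - 1))) *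
      G ^ (1 / q * (n / (n - 1)))) * A ^ ((b - r) / (a - r) * ((q - 1) / q) * (n / (n - 1))) := by
    refine hAB.trans ((mul_le_mul_of_nonneg_left (Real.rpow_le_rpow (by positivity)
      (mul_le_mul_of_nonneg_right (Real.rpow_le_rpow hB hBR (by positivity)) (by positivity))
      (by positivity)) hC.le).trans_eq ?_)
    rw [Real.mul_rpow (by positivity) (by positivity), Real.mul_rpow (by positivity) (by positivity),
      Real.mul_rpow (by positivity) (by positivity)]
    simp only [← Real.rpow_mul hR, ← Real.rpow_mul hG, ← Real.rpow_mul hA]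
    ring
  have hκ : 1 - (b - r) / (a - r) * ((q - 1) / q) * (n / (n - 1)) =
      D / (q * (a - r) * (n - 1)) := by
    rw [hDdef]
    field_simp
    linear_combination hab'
  have hA2 : A ^ (D / (q * (a - r) * (n - 1))) ≤
      C * (R ^ ((a - b) / (a - r) * ((q - 1) / q) * (n / (n - 1))) *
        G ^ (1 / q * (n / (n - 1)))) := by
    rw [← hκ, Real.rpow_sub hA0, Real.rpow_one]
    exact div_le_of_le_mul₀ (by positivity) (by positivity) hA1
  have hA3 : A ^ ((p - r) / (a - r) * (1 / p)) ≤
      (C * (R ^ ((a - b) / (a - r) * ((q - 1) / q) * (n / (n - 1))) *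
        G ^ (1 / q * (n / (n - 1))))) ^ (q * (n - 1) * (p - r) / (p * D)) := by
    have h := Real.rpow_le_rpow (by positivity) hA2
      (show 0 ≤ q * (n - 1) * (p - r) / (p * D) by positivity)
    rw [← Real.rpow_mul hA] at h
    convert h using 2
    field_simp
  calc P ^ (1 / p) ≤ (R ^ ((a - p) / (a - r)) * A ^ ((p - r) / (a - r))) ^ (1 / p) :=
        Real.rpow_le_rpow hP hPR (by positivity)
    _ = R ^ ((a - p) / (a - r) * (1 / p)) * A ^ ((p - r) / (a - r) * (1 / p)) := by
        rw [Real.mul_rpow (by positivity) (by positivity), ← Real.rpow_mul hR, ← Real.rpow_mul hA]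
    _ ≤ R ^ ((a - p) / (a - r) * (1 / p)) * _ := mul_le_mul_of_nonneg_left hA3 (by positivity)
    _ = _ := by
        have hRe : (1 - q * n * (p - r) / (p * D)) / r = (a - p) / (a - r) * (1 / p) +
            (a - b) / (a - r) * ((q - 1) / q) * (n / (n - 1)) *
              (q * (n - 1) * (p - r) / (p * D)) := by
          field_simp
          rw [hDdef]
          linear_combination (-r * (p - r)) * hab'
        have hGe : q * n * (p - r) / (p * D) / q =
            1 / q * (n / (n - 1)) * (q * (n - 1) * (p - r) / (p * D)) := by
          field_simp
        rw [hRe, hGe, Real.rpow_add_of_nonneg hR (by positivity) (by positivity),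
          Real.mul_rpow (by positivity) (by positivity),
          Real.mul_rpow (by positivity) (by positivity),
          Real.rpow_mul hR _ (q * (n - 1) * (p - r) / (p * D)),
          Real.rpow_mul hG _ (q * (n - 1) * (p - r) / (p * D))]
        ring

theorem gagliardo_nirenberg_of_two_le {N : ℕ} (hN : 2 ≤ N) {q r p : ℝ} (hq : 1 < q) (hr : 0 < r)
    (hrp : r < p) (hp : q < N → p ≤ q * N / (N - q)) (hD : 0 < (N : ℝ) * (q - r) + q * r) :
    ∃ C : ℝ, 0 < C ∧ ∀ u : EuclideanSpace ℝ (Fin N) → ℝ,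
      ContDiff ℝ 1 u → HasCompactSupport u →
      (∫ x, |u x| ^ p) ^ (1 / p)
        ≤ C * (∫ x, |u x| ^ r) ^
              ((1 - q * N * (p - r) / (p * ((N : ℝ) * (q - r) + q * r))) / r)
            * (∫ x, ‖fderiv ℝ u x‖ ^ q) ^
              ((q * N * (p - r) / (p * ((N : ℝ) * (q - r) + q * r))) / q) := by
  have hN1 : (1 : ℝ) < N := by exact_mod_cast hN
  have hN' : 0 < (N : ℝ) - 1 := sub_pos.2 hN1
  have hq' : 0 < q - 1 := sub_pos.2 hq
  obtain ⟨γ, hγ, hrb, hba, hpa⟩ := exists_sobolev_power hN1 hq hr hrp hp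
  obtain ⟨C, hC, h⟩ := exists_integral_abs_rpow_le_fderiv hN hγ hq
  refine ⟨C ^ (q * (N - 1) * (p - r) / (p * (N * (q - r) + q * r))),
    Real.rpow_pos_of_pos hC _, fun u hu hu' ↦ ?_⟩
  have hint {t : ℝ} (ht : 0 < t) : Integrable fun x ↦ |u x| ^ t :=
    hu.continuous.integrable_norm_rpow_of_hasCompactSupport hu' ht
  have hpos (t : ℝ) : 0 ≤ ∫ x, |u x| ^ t := integral_nonneg fun x ↦ by positivity
  have hra := hrp.trans_le hpa
  exact le_rpow_mul_rpow_of_interpolation hN1 hq hr hrp hrb hba hpa (by field_simp; ring) hD hC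
    (hpos _) (hpos _) (hpos r) (integral_nonneg fun x ↦ by positivity) (hpos p) (h u hu hu')
    (integral_abs_rpow_le_interpolate hr hrb hba hra hu.continuous.aestronglyMeasurable (hint hr)
      (hint (hr.trans hra)))
    (integral_abs_rpow_le_interpolate hr hrp.le hpa hra hu.continuous.aestronglyMeasurable (hint hr)
      (hint (hr.trans hra)))

theorem gagliardo_nirenberg_fin_one {q r p : ℝ} (hq : 1 < q) (hr : 0 < r) (hrp : r < p) :
    ∃ C : ℝ, 0 < C ∧ ∀ u : EuclideanSpace ℝ (Fin 1) → ℝ,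
      ContDiff ℝ 1 u → HasCompactSupport u →
      (∫ x, |u x| ^ p) ^ (1 / p)
        ≤ C * (∫ x, |u x| ^ r) ^ ((1 - q * (p - r) / (p * (q - r + q * r))) / r)
            * (∫ x, ‖fderiv ℝ u x‖ ^ q) ^ ((q * (p - r) / (p * (q - r + q * r))) / q) := by
  have hp : 0 < p := hr.trans hrp
  have hq' : 0 < q - 1 := sub_pos.2 hq
  have hpr : 0 < p - r := sub_pos.2 hrp
  have hD : 0 < q - r + q * r := by nlinarith
  set γ := 1 + r * ((q - 1) / q) with hγdef
  have hγ : 1 < γ := by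
    have : 0 < r * ((q - 1) / q) := by positivity
    linarith
  have hγr : (γ - 1) * (q / (q - 1)) = r := by
    rw [hγdef]
    field_simp
    ring
  have hγD : γ = (q - r + q * r) / q := by
    rw [hγdef]
    field_simp
    ring
  refine ⟨γ ^ ((p - r) / γ * (1 / p)), by positivity, fun u hu hu' ↦ ?_⟩
  have hint {t : ℝ} (ht : 0 < t) : Integrable fun x ↦ |u x| ^ t :=
    hu.continuous.integrable_norm_rpow_of_hasCompactSupport hu' ht
  have hpt := abs_rpow_le_fderiv_fin_one hγ hq hu hu'
  rw [hγr] at hpt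
  have hR : 0 ≤ ∫ x, |u x| ^ r := integral_nonneg fun x ↦ by positivity
  have hP : 0 ≤ ∫ x, |u x| ^ p := integral_nonneg fun x ↦ by positivity
  have hG : 0 ≤ ∫ x, ‖fderiv ℝ u x‖ ^ q := integral_nonneg fun x ↦ by positivity
  have hPR : ∫ x, |u x| ^ p ≤ (∫ x, |u x| ^ r) * (γ * ((∫ x, |u x| ^ r) ^ ((q - 1) / q) *
      (∫ x, ‖fderiv ℝ u x‖ ^ q) ^ (1 / q))) ^ ((p - r) / γ) := by
    rw [← integral_mul_const]
    refine integral_mono (hint hp) ((hint hr).mul_const _) fun x ↦ ?_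
    have hx : |u x| ^ p = |u x| ^ r * (|u x| ^ γ) ^ ((p - r) / γ) := by
      rw [← Real.rpow_mul (abs_nonneg _), ← Real.rpow_add_of_nonneg (abs_nonneg _) hr.le
        (by positivity)]
      congr 1
      field_simp
      ring
    dsimp only
    rw [hx]
    exact mul_le_mul_of_nonneg_left (Real.rpow_le_rpow (by positivity) (hpt x) (by positivity))
      (by positivity)
  generalize (∫ x, |u x| ^ p) = P at *
  generalize (∫ x, |u x| ^ r) = R at *
  generalize (∫ x, ‖fderiv ℝ u x‖ ^ q) = G at *
  refine (Real.rpow_le_rpow hP hPR (by positivity)).trans_eq ?_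
  have hRe : (1 - q * (p - r) / (p * (q - r + q * r))) / r =
      1 / p + (q - 1) / q * ((p - r) / γ * (1 / p)) := by
    rw [hγD]
    field_simp
    ring
  have hGe : q * (p - r) / (p * (q - r + q * r)) / q = 1 / q * ((p - r) / γ * (1 / p)) := by
    rw [hγD]
    field_simp
  rw [hRe, hGe, Real.rpow_add_of_nonneg hR (by positivity) (by positivity),
    Real.mul_rpow hR (by positivity), ← Real.rpow_mul (by positivity),
    Real.mul_rpow (by positivity) (by positivity), Real.mul_rpow (by positivity) (by positivity),
    ← Real.rpow_mul hR, ← Real.rpow_mul hG]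
  ring

/-- Gagliardo–Nirenberg interpolation inequality:
`‖u‖_{L^p} ≤ C·‖u‖_{L^r}^{1−λ*}·‖∇u‖_{L^q}^{λ*}` with
`λ* = qN(p−r)/(p[N(q−r)+qr])`, under the stated conditions on `p, q, r`
(where `σ = ((q−1)N+q)/(N−q)` if `q < N` and `σ = ∞` otherwise). -/
theorem gagliardo_nirenberg_interpolation (N : ℕ) (hN : 1 ≤ N) (q r p : ℝ)
    (hq : max 1 (2 * (N : ℝ) / ((N : ℝ) + 2)) < q)
    (hr1 : 1 ≤ r)
    (hrσ : q < N → r < ((q - 1) * N + q) / ((N : ℝ) - q))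
    (hrp : r < p)
    (hpσ : q < N → p < ((q - 1) * N + q) / ((N : ℝ) - q) + 1) :
    ∃ C : ℝ, 0 < C ∧ ∀ u : EuclideanSpace ℝ (Fin N) → ℝ,
      ContDiff ℝ (⊤ : ℕ∞) u → HasCompactSupport u →
      (∫ x, |u x| ^ p) ^ (1 / p)
        ≤ C * (∫ x, |u x| ^ r) ^
              ((1 - q * N * (p - r) / (p * ((N : ℝ) * (q - r) + q * r))) / r)
            * (∫ x, ‖fderiv ℝ u x‖ ^ q) ^
              ((q * N * (p - r) / (p * ((N : ℝ) * (q - r) + q * r))) / q) := by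
  have hq1 : 1 < q := (le_max_left _ _).trans_lt hq
  have hr : 0 < r := zero_lt_one.trans_le hr1
  have hσ (h : q < N) : ((q - 1) * N + q) / ((N : ℝ) - q) + 1 = q * N / (N - q) := by
    have : 0 < (N : ℝ) - q := sub_pos.2 h
    field_simp
    ring
  have hp' (h : q < N) : p < q * N / (N - q) := hσ h ▸ hpσ h
  rcases hN.eq_or_lt with rfl | hN2
  · obtain ⟨C, hC, h⟩ := gagliardo_nirenberg_fin_one hq1 hr hrp
    refine ⟨C, hC, fun u hu hu' ↦ ?_⟩
    simpa using h u (hu.of_le (by exact_mod_cast le_top)) hu'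
  · have hD : 0 < (N : ℝ) * (q - r) + q * r := by
      have hN0 : 0 < (N : ℝ) := by positivity
      rcases lt_or_ge q (N : ℝ) with h | h
      · have := (lt_div_iff₀ (sub_pos.2 h)).1 (hrp.trans (hp' h))
        linarith
      · nlinarith
    obtain ⟨C, hC, h⟩ := gagliardo_nirenberg_of_two_le hN2 hq1 hr hrp (fun h ↦ (hp' h).le) hD
    exact ⟨C, hC, fun u hu hu' ↦ h u (hu.of_le (by exact_mod_cast le_top)) hu'⟩
end

section
/- Weakly singular Gronwall inequality: let 0 < α < 1, T > 0, b ≥ 0, and let w : [0,T] → ℝ be a nonnegative continuous function satisfying w(t) ≤ b·∫₀^t (t−s)^{α−1}·w(s) ds for all t ∈ [0,T]. Then w(t) = 0 for all t ∈ [0,T]. -/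
open MeasureTheory

lemma integrableOn_Ioi_rpow_mul_exp_neg_mul {a r : ℝ} (ha : 0 < a) (hr : 0 < r) :
    IntegrableOn (fun u : ℝ => u ^ (a - 1) * Real.exp (-(r * u))) (Set.Ioi 0) := by
  refine Integrable.of_integral_ne_zero ?_
  rw [Real.integral_rpow_mul_exp_neg_mul_Ioi ha hr]
  have := Real.Gamma_pos_of_pos ha
  positivity

lemma intervalIntegral_rpow_mul_exp_neg_mul_le {a r t : ℝ} (ha : 0 < a) (hr : 0 < r)
    (ht : 0 ≤ t) :
    ∫ u in (0:ℝ)..t, u ^ (a - 1) * Real.exp (-(r * u)) ≤ (1 / r) ^ a * Real.Gamma a := by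
  rw [← Real.integral_rpow_mul_exp_neg_mul_Ioi ha hr, intervalIntegral.integral_of_le ht]
  refine setIntegral_mono_set (integrableOn_Ioi_rpow_mul_exp_neg_mul ha hr) ?_
    Set.Ioc_subset_Ioi_self.eventuallyLE
  filter_upwards [ae_restrict_mem measurableSet_Ioi] with u hu
  have hu : (0:ℝ) < u := hu
  simp only [Pi.zero_apply]
  positivity

/-- If `0 ≤ w s ≤ M * exp (r * s)` on `(0, t]`, then the Abel-type integral of `w` at `t` is at most
`M * exp (r * t)` times the Laplace transform of the kernel at `r`. -/
lemma intervalIntegral_sub_rpow_mul_le {a r t M : ℝ} {w : ℝ → ℝ} (ha : 0 < a) (hr : 0 < r)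
    (ht : 0 ≤ t) (hM : 0 ≤ M) (hw0 : ∀ s ∈ Set.Ioc 0 t, 0 ≤ w s)
    (hwM : ∀ s ∈ Set.Ioc 0 t, w s ≤ M * Real.exp (r * s)) :
    ∫ s in (0:ℝ)..t, (t - s) ^ (a - 1) * w s ≤
      M * Real.exp (r * t) * ((1 / r) ^ a * Real.Gamma a) := by
  set k : ℝ → ℝ := fun u => u ^ (a - 1) * Real.exp (-(r * u)) with hk
  have hki : IntervalIntegrable k volume 0 t :=
    (intervalIntegrable_iff_integrableOn_Ioc_of_le ht).2
      ((integrableOn_Ioi_rpow_mul_exp_neg_mul ha hr).mono_set Set.Ioc_subset_Ioi_self)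
  have hki' : IntervalIntegrable (fun s => k (t - s)) volume 0 t := by
    simpa using (hki.comp_sub_left t).symm
  calc
    ∫ s in (0:ℝ)..t, (t - s) ^ (a - 1) * w s
        ≤ ∫ s in (0:ℝ)..t, M * Real.exp (r * t) * k (t - s) := by
      rw [intervalIntegral.integral_of_le ht, intervalIntegral.integral_of_le ht]
      refine integral_mono_of_nonneg ?_
        ((intervalIntegrable_iff_integrableOn_Ioc_of_le ht).1 (hki'.const_mul _)) ?_
      · filter_upwards [ae_restrict_mem measurableSet_Ioc] with s hs
        exact mul_nonneg (Real.rpow_nonneg (sub_nonneg.2 hs.2) _) (hw0 s hs)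
      · filter_upwards [ae_restrict_mem measurableSet_Ioc] with s hs
        calc (t - s) ^ (a - 1) * w s ≤ (t - s) ^ (a - 1) * (M * Real.exp (r * s)) :=
              mul_le_mul_of_nonneg_left (hwM s hs) (Real.rpow_nonneg (sub_nonneg.2 hs.2) _)
          _ = M * Real.exp (r * t) * k (t - s) := by
              rw [show r * s = r * t + -(r * (t - s)) by ring, Real.exp_add, hk]
              ring
    _ = M * Real.exp (r * t) * ∫ u in (0:ℝ)..t, k u := by
      rw [intervalIntegral.integral_const_mul, intervalIntegral.integral_comp_sub_left]
      simp
    _ ≤ _ := by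
      gcongr
      exact intervalIntegral_rpow_mul_exp_neg_mul_le ha hr ht

/-- Weakly singular Gronwall inequality: a nonnegative continuous `w` on `[0,T]` with
`w(t) ≤ b·∫₀^t (t−s)^{α−1} w(s) ds` vanishes identically. -/
theorem weakly_singular_gronwall (α T b : ℝ) (hα0 : 0 < α) (hα1 : α < 1)
    (hT : 0 < T) (hb : 0 ≤ b)
    (w : ℝ → ℝ) (hw : ContinuousOn w (Set.Icc 0 T))
    (hwpos : ∀ t ∈ Set.Icc (0:ℝ) T, 0 ≤ w t)
    (hineq : ∀ t ∈ Set.Icc (0:ℝ) T,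
      w t ≤ b * ∫ s in (0:ℝ)..t, (t - s) ^ (α - 1) * w s) :
    ∀ t ∈ Set.Icc (0:ℝ) T, w t = 0 := by
  have hΓ := Real.Gamma_pos_of_pos hα0
  have hc : 0 < b * Real.Gamma α + 1 := by positivity
  obtain ⟨r, hr, hrα⟩ : ∃ r : ℝ, 0 < r ∧ r ^ α = b * Real.Gamma α + 1 :=
    ⟨(b * Real.Gamma α + 1) ^ α⁻¹, by positivity, Real.rpow_inv_rpow hc.le hα0.ne'⟩
  have hv : ContinuousOn (fun t => w t * Real.exp (-(r * t))) (Set.Icc 0 T) :=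
    hw.mul (by fun_prop)
  obtain ⟨t₀, ht₀, hmax⟩ := isCompact_Icc.exists_isMaxOn (Set.nonempty_Icc.2 hT.le) hv
  set M := w t₀ * Real.exp (-(r * t₀)) with hM
  have hM0 : 0 ≤ M := mul_nonneg (hwpos t₀ ht₀) (Real.exp_pos _).le
  have hle : ∀ t ∈ Set.Icc (0:ℝ) T, w t ≤ M * Real.exp (r * t) := fun t ht => by
    have h : w t * Real.exp (-(r * t)) ≤ M := hmax ht
    rwa [Real.exp_neg, ← div_eq_mul_inv, div_le_iff₀ (Real.exp_pos _)] at h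
  have hsub : ∀ s ∈ Set.Ioc 0 t₀, s ∈ Set.Icc (0:ℝ) T :=
    fun s hs => ⟨hs.1.le, hs.2.trans ht₀.2⟩
  have hwt₀ : w t₀ = M * Real.exp (r * t₀) := by
    rw [hM, mul_assoc, ← Real.exp_add, neg_add_cancel, Real.exp_zero, mul_one]
  have key : M * Real.exp (r * t₀) ≤
      M * Real.exp (r * t₀) * (b * Real.Gamma α / (b * Real.Gamma α + 1)) := by
    have h := (hineq t₀ ht₀).trans (mul_le_mul_of_nonneg_left
      (intervalIntegral_sub_rpow_mul_le hα0 hr ht₀.1 hM0 (fun s hs => hwpos s (hsub s hs))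
        (fun s hs => hle s (hsub s hs))) hb)
    rw [hwt₀, Real.div_rpow zero_le_one hr.le, Real.one_rpow, hrα] at h
    exact h.trans_eq (by ring)
  have hw0 : M * Real.exp (r * t₀) ≤ 0 := by
    rw [← mul_div_assoc, le_div_iff₀ hc] at key
    linarith
  have hM_le : M ≤ 0 := nonpos_of_mul_nonpos_left hw0 (Real.exp_pos _)
  intro t ht
  exact le_antisymm ((hle t ht).trans (mul_nonpos_of_nonpos_of_nonneg hM_le (Real.exp_pos _).le))
    (hwpos t ht)
end
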